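/- arXiv:math/0312095 — 4 statements merged into one kernel-verified Lean document; each statement's English description precedes it below -/
import Mathlib

section
/- Brianchon–Gram formula: For every full-dimensional polytope P ⊆ ℚ^d, the indicator function of P equals the alternating sum of the indicator functions of the tangent cones at all (nonempty) faces: 1_P = Σ_{F face of P} (−1)^{dim F} · 1_{T_F P}, as functions ℚ^d → ℤ (here T_P P = ℚ^d contributes (−1)^d). -/
noncomputable section
open Classical

open scoped BigOperators

/-- Indicator function of a set, with values in `ℤ`. -/
def indicator {d : ℕ} (S : Set (Fin d → ℚ)) (x : Fin d → ℚ) : ℤ :=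
  if x ∈ S then 1 else 0

/-- A polytope is the convex hull of a finite set of points. -/
def IsPolytope {d : ℕ} (P : Set (Fin d → ℚ)) : Prop :=
  ∃ T : Finset (Fin d → ℚ), P = convexHull ℚ (T : Set (Fin d → ℚ))

/-- A face of `P` is the set of maximizers of a linear functional over `P`
(taking `ℓ = 0` gives `P` itself). -/
def IsFace {d : ℕ} (P F : Set (Fin d → ℚ)) : Prop :=
  ∃ ℓ : Module.Dual ℚ (Fin d → ℚ), F = {x ∈ P | ∀ y ∈ P, ℓ y ≤ ℓ x}

/-- Dimension of the affine hull of a set. -/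
def faceDim {d : ℕ} (F : Set (Fin d → ℚ)) : ℕ :=
  Module.finrank ℚ (affineSpan ℚ F).direction

/-- The tangent cone of `P` at a face `F`. -/
def tangentCone {d : ℕ} (P F : Set (Fin d → ℚ)) : Set (Fin d → ℚ) :=
  {y | ∃ f ∈ F, ∃ x : Fin d → ℚ, y = f + x ∧ ∃ ε : ℚ, 0 < ε ∧ f + ε • x ∈ P}


set_option linter.unusedSectionVars false

section BG
variable {V : Type*} [AddCommGroup V] [Module ℚ V]

/-- Sign vector of a functional on a finite set (with value `1` outside). -/
def sgnS (S : Finset V) (f : Module.Dual ℚ V) : V → SignType :=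
  fun v => if v ∈ S then SignType.sign (f v) else 1

lemma sgnS_finite (S : Finset V) : (Set.range (sgnS S)).Finite := by
  apply Set.Finite.subset (Set.finite_range
    (fun g : S → SignType => fun v : V => if h : v ∈ S then g ⟨v, h⟩ else 1))
  rintro _ ⟨f, rfl⟩
  refine ⟨fun v => SignType.sign (f v.1), ?_⟩
  funext v
  by_cases h : v ∈ S <;> simp [sgnS, h]

def cellsF (S : Finset V) : Finset (V → SignType) := (sgnS_finite S).toFinset

lemma mem_cellsF {S : Finset V} {σ : V → SignType} :
    σ ∈ cellsF S ↔ ∃ f, sgnS S f = σ := by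
  simp [cellsF]

def rkσ (σ : V → SignType) : ℕ := Module.finrank ℚ (Submodule.span ℚ {v | σ v = 0})

lemma exists_small (S : Finset V) (g h : Module.Dual ℚ V) :
    ∃ ε : ℚ, 0 < ε ∧ ∀ v ∈ S, g v ≠ 0 → ε * |h v| < |g v| := by
  induction S using Finset.induction_on with
  | empty => exact ⟨1, one_pos, by simp⟩
  | insert a S ha ih =>
    obtain ⟨ε, he, H⟩ := ih
    by_cases hg : g a = 0
    · refine ⟨ε, he, ?_⟩
      intro v hv hgv
      rcases Finset.mem_insert.1 hv with rfl | hv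
      · exact absurd hg hgv
      · exact H v hv hgv
    · have hpos : 0 < |g a| := abs_pos.2 hg
      have hp1 : 0 < |h a| + 1 := by positivity
      refine ⟨min ε (|g a| / (|h a| + 1)), lt_min he (div_pos hpos hp1), ?_⟩
      intro v hv hgv
      rcases Finset.mem_insert.1 hv with rfl | hv
      · calc min ε (|g v| / (|h v| + 1)) * |h v| ≤ (|g v| / (|h v| + 1)) * |h v| :=
              mul_le_mul_of_nonneg_right (min_le_right _ _) (abs_nonneg _)
          _ < (|g v| / (|h v| + 1)) * (|h v| + 1) :=
              mul_lt_mul_of_pos_left (by linarith) (div_pos hpos hp1)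
          _ = |g v| := by field_simp
      · exact lt_of_le_of_lt (mul_le_mul_of_nonneg_right (min_le_left _ _) (abs_nonneg _))
          (H v hv hgv)

lemma sign_add_small {a b : ℚ} (h : |b| < |a|) : SignType.sign (a + b) = SignType.sign a := by
  rcases lt_trichotomy a 0 with ha | ha | ha
  · rw [abs_of_neg ha] at h
    rw [sign_neg ha, sign_neg]
    linarith [le_abs_self b]
  · subst ha
    simp at h
    exact absurd h (not_lt.2 (abs_nonneg b))
  · rw [abs_of_pos ha] at h
    rw [sign_pos ha, sign_pos]
    linarith [neg_abs_le b]

lemma perturb (S : Finset V) (g h : Module.Dual ℚ V) (hz : ∀ v, sgnS S g v = 0 → h v = 0) :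
    ∃ ε : ℚ, 0 < ε ∧ sgnS S (g + ε • h) = sgnS S g ∧ sgnS S (g - ε • h) = sgnS S g := by
  obtain ⟨ε, he, H⟩ := exists_small S g h
  have key : ∀ δ : ℚ, |δ| = ε → sgnS S (g + δ • h) = sgnS S g := by
    intro δ hδ
    funext v
    by_cases hv : v ∈ S
    · simp only [sgnS, hv, if_true, LinearMap.add_apply, LinearMap.smul_apply, smul_eq_mul]
      by_cases hg : g v = 0
      · have : h v = 0 := hz v (by simp [sgnS, hv, hg])
        simp [this]
      · apply sign_add_small
        rw [abs_mul, hδ]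
        exact H v hv hg
    · simp [sgnS, hv]
  refine ⟨ε, he, key ε (abs_of_pos he), ?_⟩
  have := key (-ε) (by rw [abs_neg, abs_of_pos he])
  rwa [neg_smul, ← sub_eq_add_neg] at this

lemma sgnS_insert {S : Finset V} {q : V} (hq : q ∉ S) (f : Module.Dual ℚ V) :
    sgnS (insert q S) f = Function.update (sgnS S f) q (SignType.sign (f q)) := by
  funext v
  by_cases hv : v = q
  · subst hv
    simp [sgnS]
  · simp [sgnS, hv]

lemma cell_out {S : Finset V} {σ : V → SignType} (h : σ ∈ cellsF S) {q : V} (hq : q ∉ S) :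
    σ q = 1 := by
  obtain ⟨f, rfl⟩ := mem_cellsF.1 h
  simp [sgnS, hq]

lemma sum_insert_cells {S : Finset V} {q : V} (hq : q ∉ S) (G : (V → SignType) → ℤ) :
    ∑ σ ∈ cellsF (insert q S), G σ =
      ∑ σ ∈ cellsF S, ∑ s : SignType,
        if ∃ f, sgnS S f = σ ∧ SignType.sign (f q) = s then G (Function.update σ q s) else 0 := by
  rw [← Finset.sum_product', ← Finset.sum_filter]
  symm
  apply Finset.sum_nbij (fun x => Function.update x.1 q x.2)
  · rintro ⟨σ, s⟩ h
    simp only [Finset.mem_filter] at h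
    obtain ⟨-, f, rfl, rfl⟩ := h
    exact mem_cellsF.2 ⟨f, sgnS_insert hq f⟩
  · rintro ⟨σ, s⟩ h ⟨σ', s'⟩ h' heq
    simp only [Finset.coe_filter, Finset.mem_product, Set.mem_ofPred_eq] at h h'
    have h1 := cell_out h.1.1 hq
    have h2 := cell_out h'.1.1 hq
    simp only at heq
    have e2 : s = s' := by simpa using congrFun heq q
    have e1 : σ = σ' := by
      funext v
      by_cases hv : v = q
      · subst hv; exact h1.trans h2.symm
      · simpa [hv] using congrFun heq v
    rw [e1, e2]
  · intro τ hτ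
    obtain ⟨f, rfl⟩ := mem_cellsF.1 (Finset.mem_coe.1 hτ)
    refine ⟨(sgnS S f, SignType.sign (f q)), ?_, (sgnS_insert hq f).symm⟩
    simp only [Finset.coe_filter, Set.mem_ofPred_eq, Finset.mem_product]
    exact ⟨⟨mem_cellsF.2 ⟨f, rfl⟩, Finset.mem_univ _⟩, f, rfl, rfl⟩
  · intros; rfl

lemma sum_sign (F : SignType → ℤ) : ∑ s : SignType, F s = F 0 + F 1 + F (-1) := by
  have : (Finset.univ : Finset SignType) = {0, 1, -1} := by decide
  rw [this, Finset.sum_insert (by decide), Finset.sum_insert (by decide), Finset.sum_singleton]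
  ring

lemma zero_update_ne {σ : V → SignType} {q : V} (h1 : σ q = 1) {s : SignType} (hs : s ≠ 0) :
    rkσ (Function.update σ q s) = rkσ σ := by
  unfold rkσ
  have : {v | Function.update σ q s v = 0} = {v | σ v = 0} := by
    ext v
    by_cases hv : v = q
    · subst hv; simp [h1, hs]
    · simp [hv]
  rw [this]

lemma span_update {σ : V → SignType} {q : V} (h1 : σ q = 1) :
    Submodule.span ℚ {v | Function.update σ q 0 v = 0} =
      Submodule.span ℚ {v | σ v = 0} ⊔ Submodule.span ℚ {q} := by
  have : {v | Function.update σ q 0 v = 0} = {v | σ v = 0} ∪ {q} := by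
    ext v
    by_cases hv : v = q
    · subst hv; simp
    · simp [hv]
  rw [this, Submodule.span_union]

lemma vanish_span {S : Finset V} (f : Module.Dual ℚ V) {q : V}
    (hq : q ∈ Submodule.span ℚ {v | sgnS S f v = 0}) : f q = 0 := by
  have : Submodule.span ℚ {v | sgnS S f v = 0} ≤ LinearMap.ker f := by
    rw [Submodule.span_le]
    intro v hv
    simp only [Set.mem_ofPred_eq, sgnS] at hv
    split_ifs at hv
    · simpa using hv
  exact this hq

/-- trichotomy for a new vector -/
lemma cell_cases [Module.Finite ℚ V] {S : Finset V} {σ : V → SignType} (hσ : σ ∈ cellsF S)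
    {q : V} (hq : q ∉ S) :
    ((∀ f, sgnS S f = σ → f q = 0) ∧ rkσ (Function.update σ q 0) = rkσ σ) ∨
    ((∀ s : SignType, ∃ f, sgnS S f = σ ∧ SignType.sign (f q) = s) ∧
      rkσ (Function.update σ q 0) = rkσ σ + 1) ∨
    (∀ f, sgnS S f = σ → 0 < f q) ∨ (∀ f, sgnS S f = σ → f q < 0) := by
  have h1 := cell_out hσ hq
  by_cases hz : ∃ g, sgnS S g = σ ∧ g q = 0
  · obtain ⟨g, hg, hgq⟩ := hz
    by_cases hs : q ∈ Submodule.span ℚ {v | σ v = 0}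
    · left
      refine ⟨?_, ?_⟩
      · rintro f rfl
        exact vanish_span f hs
      · unfold rkσ
        rw [span_update h1, sup_eq_left.2]
        rw [Submodule.span_singleton_le_iff_mem]
        exact hs
    · right; left
      refine ⟨?_, ?_⟩
      · obtain ⟨h, hhq, hker⟩ := Submodule.exists_le_ker_of_notMem hs
        obtain ⟨h, hhq, hker⟩ : ∃ h : Module.Dual ℚ V, 0 < h q ∧
            Submodule.span ℚ {v | σ v = 0} ≤ LinearMap.ker h := by
          rcases lt_or_gt_of_ne hhq with hlt | hlt
          · refine ⟨-h, by simpa using hlt, ?_⟩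
            intro v hv
            have := hker hv
            simpa using this
          · exact ⟨h, hlt, hker⟩
        obtain ⟨ε, he, e1, e2⟩ := perturb S g h (by
          intro v hv
          rw [hg] at hv
          exact hker (Submodule.subset_span hv))
        rw [hg] at e1 e2
        intro s
        have hp : 0 < ε * h q := mul_pos he hhq
        rcases s with _ | _ | _
        · exact ⟨g, hg, by rw [hgq]; simp⟩
        · refine ⟨_, e2, ?_⟩
          rw [sign_neg (by simp [hgq, hp])]; rfl
        · refine ⟨_, e1, ?_⟩
          rw [sign_pos (by simp [hgq, hp])]; rfl
      · unfold rkσ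
        rw [span_update h1]
        rw [Submodule.finrank_sup_span_singleton hs]
  · push Not at hz
    right; right
    by_contra hcon
    push Not at hcon
    obtain ⟨⟨f, hf, hfq⟩, g, hg, hgq⟩ := hcon
    have hf' : f q < 0 := lt_of_le_of_ne hfq (hz f hf)
    have hg' : 0 < g q := lt_of_le_of_ne hgq (hz g hg).symm
    refine hz ((g q) • f + (- f q) • g) ?_ (by simp; ring)
    funext v
    have ef := congrFun hf v
    have eg := congrFun hg v
    simp only [sgnS] at ef eg ⊢
    split_ifs at ef eg ⊢ with hv
    · rw [← ef]
      rw [← eg] at ef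
      simp only [LinearMap.add_apply, LinearMap.smul_apply, smul_eq_mul]
      have hfn : 0 < - f q := by linarith
      rcases lt_trichotomy (f v) 0 with h | h | h
      · rw [sign_neg h] at ef
        have hg2 := sign_eq_neg_one_iff.1 ef.symm
        rw [sign_neg h, sign_neg]
        have := mul_neg_of_pos_of_neg hg' h
        have := mul_neg_of_pos_of_neg hfn hg2
        linarith
      · rw [h, sign_zero] at ef
        have hg2 := sign_eq_zero_iff.1 ef.symm
        rw [h, hg2]; simp
      · rw [sign_pos h] at ef
        have hg2 := sign_eq_one_iff.1 ef.symm
        rw [sign_pos h, sign_pos]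
        have := mul_pos hg' h
        have := mul_pos hfn hg2
        linarith
    · exact ef

def Φ (R S : Finset V) : ℤ :=
  ∑ σ ∈ cellsF S, if ∀ v ∈ R, σ v ≠ -1 then (-1 : ℤ) ^ rkσ σ else 0

lemma upd_R {R S : Finset V} (hRS : R ⊆ S) {q : V} (hq : q ∉ S) (σ : V → SignType) (s : SignType) :
    (∀ v ∈ R, Function.update σ q s v ≠ -1) ↔ (∀ v ∈ R, σ v ≠ -1) := by
  apply forall₂_congr
  intro v hv
  have : v ≠ q := by rintro rfl; exact hq (hRS hv)
  simp [this]

lemma exists_cell {S : Finset V} {σ : V → SignType} (hσ : σ ∈ cellsF S) {q : V}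
    {s : SignType} (h : ∀ f, sgnS S f = σ → SignType.sign (f q) = s) (t : SignType) :
    (∃ f, sgnS S f = σ ∧ SignType.sign (f q) = t) ↔ t = s := by
  obtain ⟨f, hf⟩ := mem_cellsF.1 hσ
  constructor
  · rintro ⟨f, hf, rfl⟩
    exact h f hf
  · rintro rfl
    exact ⟨f, hf, h f hf⟩

lemma Φ_free [Module.Finite ℚ V] {R S : Finset V} (hRS : R ⊆ S) {q : V} (hq : q ∉ S) :
    Φ R (insert q S) = Φ R S := by
  unfold Φ
  rw [sum_insert_cells hq]
  apply Finset.sum_congr rfl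
  intro σ hσ
  have h1 := cell_out hσ hq
  simp only [upd_R hRS hq]
  by_cases hR : ∀ v ∈ R, σ v ≠ -1
  swap
  · simp [hR]
  simp only [if_pos hR]
  rw [sum_sign, zero_update_ne h1 (s := 1) (by decide), zero_update_ne h1 (s := -1) (by decide)]
  rcases cell_cases hσ hq with ⟨h, e⟩ | ⟨h, e⟩ | h | h
  · simp only [exists_cell (s := 0) hσ (fun f hf => by rw [h f hf]; simp)]
    rw [e]; simp
  · simp only [h, if_true]
    rw [e]; ring
  · simp only [exists_cell (s := 1) hσ (fun f hf => sign_pos (h f hf))]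
    simp
  · simp only [exists_cell (s := -1) hσ (fun f hf => sign_neg (h f hf))]
    simp

lemma Φ_step [Module.Finite ℚ V] {R S : Finset V} (hRS : R ⊆ S) {q : V} (hq : q ∉ S) :
    Φ (insert q R) (insert q S) = ∑ σ ∈ cellsF S,
      if (∀ v ∈ R, σ v ≠ -1) ∧ (∀ f, sgnS S f = σ → 0 ≤ f q) then (-1 : ℤ) ^ rkσ σ else 0 := by
  unfold Φ
  rw [sum_insert_cells hq]
  apply Finset.sum_congr rfl
  intro σ hσ
  have h1 := cell_out hσ hq
  simp only [Finset.forall_mem_insert, Function.update_self, upd_R hRS hq]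
  by_cases hR : ∀ v ∈ R, σ v ≠ -1
  swap
  · simp [hR]
  obtain ⟨f0, hf0⟩ := mem_cellsF.1 hσ
  simp only [eq_true hR, and_true, true_and]
  rw [sum_sign, zero_update_ne h1 (s := 1) (by decide), zero_update_ne h1 (s := -1) (by decide)]
  rcases cell_cases hσ hq with ⟨h, e⟩ | ⟨h, e⟩ | h | h
  · simp only [exists_cell (s := 0) hσ (fun f hf => by rw [h f hf]; simp)]
    rw [e, if_pos (fun f hf => (h f hf).ge)]; simp
  · have : ¬ ∀ f, sgnS S f = σ → 0 ≤ f q := by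
      intro h'
      obtain ⟨f, hf, hs⟩ := h (-1)
      exact absurd (h' f hf) (not_le.2 (sign_eq_neg_one_iff.1 hs))
    simp only [h, if_true]
    rw [e, if_neg this]; simp; ring
  · simp only [exists_cell (s := 1) hσ (fun f hf => sign_pos (h f hf))]
    rw [if_pos (fun f hf => (h f hf).le)]
    simp
  · simp only [exists_cell (s := -1) hσ (fun f hf => sign_neg (h f hf))]
    have hn : ¬ ∀ f, sgnS S f = σ → 0 ≤ f q :=
      fun h' => absurd (h' f0 hf0) (not_le.2 (h f0 hf0))
    rw [eq_false hn]
    simp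

lemma Φ_free_union [Module.Finite ℚ V] {R S : Finset V} (hRS : R ⊆ S) (B : Finset V) :
    Φ R (B ∪ S) = Φ R S := by
  induction B using Finset.induction_on with
  | empty => simp
  | insert b B hb ih =>
    rw [Finset.insert_union]
    by_cases h : b ∈ B ∪ S
    · rw [Finset.insert_eq_of_mem h, ih]
    · rw [Φ_free (hRS.trans Finset.subset_union_right) h, ih]


def upσ (S : Finset V) (σ : V → SignType) : V → SignType :=
  fun v => if v ∈ S then 1 else σ v

def downσ (S : Finset V) (σ : V → SignType) : V → SignType :=
  fun v => if v ∈ S then (if ∀ w ∈ S, σ (v - w) ≠ 1 then 0 else 1) else σ v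

lemma Φ_zero [Module.Finite ℚ V] {S : Finset V} (hS : S.Nonempty) (f0 : Module.Dual ℚ V)
    (h0 : ∀ v ∈ S, f0 v = 1) : Φ S S = 0 := by
  set B : Finset V := (S ×ˢ S).image (fun x => x.1 - x.2) with hB
  have hBmem : ∀ v ∈ S, ∀ w ∈ S, v - w ∈ B := by
    intro v hv w hw
    exact Finset.mem_image.2 ⟨(v, w), Finset.mem_product.2 ⟨hv, hw⟩, rfl⟩
  have hB0 : ∀ b ∈ B, f0 b = 0 := by
    intro b hb
    obtain ⟨⟨v, w⟩, hvw, rfl⟩ := Finset.mem_image.1 hb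
    obtain ⟨hv, hw⟩ := Finset.mem_product.1 hvw
    simp [h0 v hv, h0 w hw]
  have hBS : ∀ b ∈ B, b ∉ S := by
    intro b hb hbS
    have e1 := hB0 b hb
    have e2 := h0 b hbS
    rw [e1] at e2
    exact zero_ne_one e2
  have hdS : ∀ v ∈ S, ∀ w ∈ S, v - w ∉ S := fun v hv w hw => hBS _ (hBmem v hv w hw)
  rw [← Φ_free_union (Finset.Subset.refl S) B]
  unfold Φ
  rw [← Finset.sum_filter]
  set U := B ∪ S with hU
  have hSU : ∀ v ∈ S, v ∈ U := fun v hv => Finset.mem_union_right _ hv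
  have hBU : ∀ v ∈ B, v ∈ U := fun v hv => Finset.mem_union_left _ hv
  have hnn : ∀ f, (∀ v ∈ S, sgnS U f v ≠ -1) → ∀ v ∈ S, 0 ≤ f v := by
    intro f hf v hv
    have := hf v hv
    simp only [sgnS, hSU v hv, if_true] at this
    by_contra hlt
    exact this (sign_neg (not_le.1 hlt))
  have hout : ∀ f (c : ℚ) v, v ∉ S → sgnS U (f + c • f0) v = sgnS U f v := by
    intro f c v hv
    simp only [sgnS]
    split_ifs with h
    · rcases Finset.mem_union.1 h with h | h
      · simp [hB0 v h]
      · exact absurd h hv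
    · rfl
  -- up
  have hup : ∀ f, (∀ v ∈ S, sgnS U f v ≠ -1) → upσ S (sgnS U f) = sgnS U (f + (1 : ℚ) • f0) := by
    intro f hf
    funext v
    by_cases hv : v ∈ S
    · have h1 := hnn f hf v hv
      simp only [upσ, hv, if_true, sgnS, hSU v hv]
      rw [sign_pos]
      simp [h0 v hv]
      linarith
    · rw [hout f 1 v hv]
      simp [upσ, hv]
  have hdown : ∀ f, ∃ v0 ∈ S, (∀ v ∈ S, f v0 ≤ f v) ∧
      downσ S (sgnS U f) = sgnS U (f + (- f v0) • f0) := by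
    intro f
    obtain ⟨v0, hv0, hmin⟩ := Finset.exists_min_image S (fun v => f v) hS
    refine ⟨v0, hv0, hmin, ?_⟩
    funext v
    by_cases hv : v ∈ S
    · have hd : ∀ w ∈ S, sgnS U f (v - w) = SignType.sign (f v - f w) := by
        intro w hw
        simp [sgnS, hBU _ (hBmem v hv w hw)]
      have e : (f + (- f v0) • f0) v = f v - f v0 := by
        simp [h0 v hv]; ring
      simp only [downσ, hv, if_true]
      have e' : sgnS U (f + (- f v0) • f0) v = SignType.sign (f v - f v0) := by
        simp only [sgnS, hSU v hv, if_true, e]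
      rw [e']
      split_ifs with h
      · have h2 := h v0 hv0
        rw [hd v0 hv0] at h2
        have h3 : f v - f v0 = 0 := by
          refine le_antisymm ?_ (sub_nonneg.2 (hmin v hv))
          by_contra hlt
          exact h2 (sign_pos (not_le.1 hlt))
        rw [h3, sign_zero]
      · push Not at h
        obtain ⟨w, hw, h2⟩ := h
        rw [hd w hw] at h2
        have h3 := sign_eq_one_iff.1 h2
        have h4 := hmin w hw
        rw [sign_pos]
        linarith
    · rw [hout f _ v hv]
      simp [downσ, hv]
  have hdown_nn : ∀ f, (∀ v ∈ S, downσ S (sgnS U f) v ≠ -1) := by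
    intro f v hv
    simp only [downσ, hv, if_true]
    split_ifs <;> decide
  have hdown_eq : ∀ f, (∀ v ∈ S, sgnS U f v ≠ -1) → (∃ v ∈ S, sgnS U f v = 0) →
      downσ S (sgnS U f) = sgnS U f := by
    intro f hf ⟨v, hv, hz⟩
    obtain ⟨v0, hv0, hmin, e⟩ := hdown f
    have : f v0 = 0 := by
      refine le_antisymm ?_ (hnn f hf v0 hv0)
      simp only [sgnS, hSU v hv, if_true, sign_eq_zero_iff] at hz
      rw [← hz]
      exact hmin v hv
    rw [e, this]
    simp
  have hupdown : ∀ σ, upσ S (downσ S σ) = upσ S σ := by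
    intro σ; funext v
    by_cases hv : v ∈ S <;> simp [upσ, downσ, hv]
  have hdownup : ∀ σ, downσ S (upσ S σ) = downσ S σ := by
    intro σ; funext v
    by_cases hv : v ∈ S
    · simp only [downσ, hv, if_true]
      have : (∀ w ∈ S, upσ S σ (v - w) ≠ 1) ↔ (∀ w ∈ S, σ (v - w) ≠ 1) := by
        apply forall₂_congr
        intro w hw
        simp [upσ, hdS v hv w hw]
      simp only [this]
    · simp [upσ, downσ, hv]
  have hrk : ∀ f, (∃ v ∈ S, sgnS U f v = 0) →
      rkσ (sgnS U f) = rkσ (upσ S (sgnS U f)) + 1 := by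
    rintro f ⟨v0, hv0, hz⟩
    have hz' : f v0 = 0 := by
      simpa [sgnS, hSU v0 hv0] using hz
    unfold rkσ
    have hnot : v0 ∉ Submodule.span ℚ {v | upσ S (sgnS U f) v = 0} := by
      intro hmem
      have hle : Submodule.span ℚ {v | upσ S (sgnS U f) v = 0} ≤ LinearMap.ker f0 := by
        rw [Submodule.span_le]
        intro v hv
        simp only [Set.mem_ofPred_eq, upσ, sgnS] at hv
        split_ifs at hv with h1 h2
        · rcases Finset.mem_union.1 h2 with h | h
          · exact hB0 v h
          · exact absurd h h1
      have : f0 v0 = 0 := hle hmem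
      rw [h0 v0 hv0] at this
      exact one_ne_zero this
    rw [← Submodule.finrank_sup_span_singleton hnot]
    have hsp : Submodule.span ℚ {v | sgnS U f v = 0} =
        Submodule.span ℚ {v | upσ S (sgnS U f) v = 0} ⊔ Submodule.span ℚ {v0} := ?_
    · rw [hsp]
    apply le_antisymm
    · rw [Submodule.span_le]
      intro v hv
      simp only [Set.mem_ofPred_eq] at hv
      by_cases hvS : v ∈ S
      · have hv' : f v = 0 := by simpa [sgnS, hSU v hvS] using hv
        have : v = (v - v0) + v0 := by abel
        rw [this]
        apply Submodule.add_mem_sup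
        · apply Submodule.subset_span
          simp [upσ, hdS v hvS v0 hv0, sgnS, hBU _ (hBmem v hvS v0 hv0), hz', hv']
        · exact Submodule.mem_span_singleton_self v0
      · apply Submodule.mem_sup_left
        apply Submodule.subset_span
        simpa [upσ, hvS] using hv
    · rw [sup_le_iff]
      constructor
      · apply Submodule.span_mono
        intro v hv
        simp only [Set.mem_ofPred_eq, upσ] at hv ⊢
        split_ifs at hv
        exact hv
      · rw [Submodule.span_singleton_le_iff_mem]
        exact Submodule.subset_span hz
  rw [← Finset.sum_filter_add_sum_filter_not _ (fun σ => ∃ v ∈ S, σ v = 0)]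
  rw [add_eq_zero_iff_eq_neg, ← Finset.sum_neg_distrib]
  apply Finset.sum_nbij' (upσ S) (downσ S)
  · intro σ hσ
    simp only [Finset.mem_filter] at hσ ⊢
    obtain ⟨⟨hc, hn⟩, hz⟩ := hσ
    obtain ⟨f, rfl⟩ := mem_cellsF.1 hc
    refine ⟨⟨?_, ?_⟩, ?_⟩
    · rw [hup f hn]; exact mem_cellsF.2 ⟨_, rfl⟩
    · intro v hv; simp [upσ, hv]
    · rintro ⟨v, hv, h⟩; simp [upσ, hv] at h
  · intro σ hσ
    simp only [Finset.mem_filter] at hσ ⊢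
    obtain ⟨⟨hc, hn⟩, hz⟩ := hσ
    obtain ⟨f, rfl⟩ := mem_cellsF.1 hc
    refine ⟨⟨?_, hdown_nn f⟩, ?_⟩
    · obtain ⟨v0, -, -, e⟩ := hdown f
      rw [e]; exact mem_cellsF.2 ⟨_, rfl⟩
    · obtain ⟨v0, hv0, -, e⟩ := hdown f
      refine ⟨v0, hv0, ?_⟩
      rw [e]
      simp [sgnS, hSU v0 hv0, h0 v0 hv0]
  · intro σ hσ
    simp only [Finset.mem_filter] at hσ
    obtain ⟨⟨hc, hn⟩, hz⟩ := hσ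
    obtain ⟨f, rfl⟩ := mem_cellsF.1 hc
    rw [hdownup, hdown_eq f hn hz]
  · intro σ hσ
    simp only [Finset.mem_filter] at hσ
    obtain ⟨⟨hc, hn⟩, hz⟩ := hσ
    obtain ⟨f, rfl⟩ := mem_cellsF.1 hc
    rw [hupdown]
    funext v
    by_cases hv : v ∈ S
    · simp only [upσ, hv, if_true]
      have h1 := hn v hv
      have h2 : sgnS U f v ≠ 0 := fun h => hz ⟨v, hv, h⟩
      revert h1 h2
      generalize sgnS U f v = s
      revert s
      decide
    · simp [upσ, hv]
  · intro σ hσ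
    simp only [Finset.mem_filter] at hσ
    obtain ⟨⟨hc, hn⟩, hz⟩ := hσ
    obtain ⟨f, rfl⟩ := mem_cellsF.1 hc
    rw [hrk f hz]
    ring

/-- combined vanishing statement -/
lemma sum_vanish [Module.Finite ℚ V] (S : Finset V) (p : V) (f0 : Module.Dual ℚ V)
    (h0 : ∀ v ∈ S, f0 v = 1) (hp : f0 p = 1) :
    ∑ σ ∈ cellsF S, (if (∀ v ∈ S, σ v ≠ -1) ∧ (∀ f, sgnS S f = σ → 0 ≤ f p)
      then (-1 : ℤ) ^ rkσ σ else 0) = 0 := by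
  by_cases hpS : p ∈ S
  · refine Eq.trans ?_ (Φ_zero ⟨p, hpS⟩ f0 h0)
    unfold Φ
    apply Finset.sum_congr rfl
    intro σ _
    apply if_congr _ rfl rfl
    constructor
    · exact fun h => h.1
    · refine fun h => ⟨h, ?_⟩
      rintro f rfl
      have := h p hpS
      simp only [sgnS, hpS, if_true] at this
      by_contra hlt
      exact this (sign_neg (not_le.1 hlt))
  · rw [← Φ_step (Finset.Subset.refl S) hpS]
    apply Φ_zero (Finset.insert_nonempty _ _) f0
    intro v hv
    rcases Finset.mem_insert.1 hv with rfl | hv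
    · exact hp
    · exact h0 v hv

/-- Farkas' lemma over `ℚ`. -/
lemma farkas {ι : Type*} (s : Finset ι) (c : ι → V) (p : V) :
    (∃ w : ι → ℚ, (∀ i, 0 ≤ w i) ∧ p = ∑ i ∈ s, w i • c i) ∨
    (∃ f : Module.Dual ℚ V, (∀ i ∈ s, 0 ≤ f (c i)) ∧ f p < 0) := by
  induction s using Finset.induction_on generalizing c p with
  | empty =>
    by_cases hp : p = 0
    · left; exact ⟨fun _ => 0, by simp, by simp [hp]⟩
    · right
      have hp' : p ∉ (⊥ : Submodule ℚ V) := by simpa using hp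
      obtain ⟨f, hf, -⟩ := Submodule.exists_le_ker_of_notMem hp'
      rcases lt_or_gt_of_ne hf with h | h
      · exact ⟨f, by simp, h⟩
      · exact ⟨-f, by simp, by simpa using h⟩
  | insert a s ha ih =>
    rcases ih c p with ⟨w, hw, e⟩ | ⟨f, hf, hfp⟩
    · left
      refine ⟨fun i => if i = a then 0 else w i, ?_, ?_⟩
      · intro i
        dsimp only
        split_ifs
        · exact le_rfl
        · exact hw i
      · rw [Finset.sum_insert ha, e]
        simp only [if_true, zero_smul, zero_add]
        apply Finset.sum_congr rfl
        intro i hi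
        rw [if_neg (by rintro rfl; exact ha hi)]
    · by_cases hfa : 0 ≤ f (c a)
      · right
        exact ⟨f, by simpa [hfa] using hf, hfp⟩
      · have hfa' : f (c a) < 0 := not_le.1 hfa
        have hne : f (c a) ≠ 0 := hfa'.ne
        let π : V →ₗ[ℚ] V := LinearMap.id - (LinearMap.toSpanSingleton ℚ V (c a)).comp
          ((f (c a))⁻¹ • f)
        have hπ : ∀ v, π v = v - ((f (c a))⁻¹ * f v) • c a := by
          intro v; simp [π]
        rcases ih (fun i => π (c i)) (π p) with ⟨w, hw, e⟩ | ⟨g, hg, hgp⟩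
        · left
          set t : ℚ := (f (c a))⁻¹ * (f p - ∑ i ∈ s, w i * f (c i)) with ht
          have ht0 : 0 ≤ t := by
            have : 0 ≤ ∑ i ∈ s, w i * f (c i) :=
              Finset.sum_nonneg fun i hi => mul_nonneg (hw i) (hf i hi)
            apply mul_nonneg_of_nonpos_of_nonpos
            · exact (inv_lt_zero.2 hfa').le
            · linarith
          refine ⟨fun i => if i = a then t else w i, ?_, ?_⟩
          · intro i
            dsimp only
            split_ifs
            · exact ht0
            · exact hw i
          · rw [Finset.sum_insert ha]
            simp only [if_true]
            have e2 : ∑ i ∈ s, (if i = a then t else w i) • c i = ∑ i ∈ s, w i • c i := by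
              apply Finset.sum_congr rfl
              intro i hi
              rw [if_neg (by rintro rfl; exact ha hi)]
            rw [e2]
            have e3 : ∑ i ∈ s, w i • π (c i) =
                ∑ i ∈ s, w i • c i - ((f (c a))⁻¹ * ∑ i ∈ s, w i * f (c i)) • c a := by
              simp only [hπ, smul_sub, Finset.sum_sub_distrib, smul_smul]
              rw [Finset.mul_sum, Finset.sum_smul]
              congr 1
              apply Finset.sum_congr rfl
              intro i _
              congr 1
              ring
            rw [e3, hπ] at e
            rw [ht, mul_sub, sub_smul]
            rw [sub_eq_iff_eq_add] at e
            refine e.trans ?_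
            abel
        · right
          refine ⟨g.comp π, ?_, hgp⟩
          intro i hi
          rcases Finset.mem_insert.1 hi with rfl | hi
          · have : π (c i) = 0 := by
              rw [hπ, inv_mul_cancel₀ hne, one_smul, sub_self]
            simp [this]
          · exact hg i hi

end BG

section BG2
variable {d : ℕ}

/-- lift of the points to height one -/
def liftS (T : Finset (Fin d → ℚ)) : Finset ((Fin d → ℚ) × ℚ) :=
  T.image (fun t => (t, (1 : ℚ)))

lemma mem_liftS {T : Finset (Fin d → ℚ)} {t : Fin d → ℚ} : (t, (1 : ℚ)) ∈ liftS T ↔ t ∈ T := by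
  simp [liftS]

lemma sgn_lift {T : Finset (Fin d → ℚ)} {t : Fin d → ℚ} (ht : t ∈ T)
    (f : Module.Dual ℚ ((Fin d → ℚ) × ℚ)) :
    sgnS (liftS T) f (t, 1) = SignType.sign (f (t, 1)) := by
  simp [sgnS, mem_liftS.2 ht]

lemma flin (f : Module.Dual ℚ ((Fin d → ℚ) × ℚ)) (y z : Fin d → ℚ) {a b : ℚ} (h : a + b = 1) :
    f (a • y + b • z, 1) = a * f (y, 1) + b * f (z, 1) := by
  have : ((a • y + b • z, 1) : (Fin d → ℚ) × ℚ) = a • (y, 1) + b • (z, 1) := by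
    ext <;> simp [h]
  rw [this, map_add, map_smul, map_smul, smul_eq_mul, smul_eq_mul]

/-- zero points of a sign vector -/
def Zσ (σ : (Fin d → ℚ) × ℚ → SignType) : Set (Fin d → ℚ) := {t | σ (t, 1) = 0}

lemma mem_Z {T : Finset (Fin d → ℚ)} {f : Module.Dual ℚ ((Fin d → ℚ) × ℚ)} {t : Fin d → ℚ} :
    t ∈ Zσ (sgnS (liftS T) f) ↔ t ∈ T ∧ f (t, 1) = 0 := by
  by_cases ht : t ∈ T <;> simp [Zσ, sgnS, mem_liftS, ht]

lemma nn_iff {T : Finset (Fin d → ℚ)} {f : Module.Dual ℚ ((Fin d → ℚ) × ℚ)} :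
    (∀ v ∈ liftS T, sgnS (liftS T) f v ≠ -1) ↔ ∀ t ∈ T, 0 ≤ f (t, 1) := by
  constructor
  · intro h t ht
    have := h (t, 1) (mem_liftS.2 ht)
    rw [sgn_lift ht] at this
    by_contra hlt
    exact this (sign_neg (not_le.1 hlt))
  · intro h v hv
    obtain ⟨t, ht, rfl⟩ := Finset.mem_image.1 hv
    rw [sgn_lift ht]
    intro h2
    exact absurd (h t ht) (not_le.2 (sign_eq_neg_one_iff.1 h2))

lemma convZ {T : Finset (Fin d → ℚ)} {f : Module.Dual ℚ ((Fin d → ℚ) × ℚ)}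
    (hf : ∀ t ∈ T, 0 ≤ f (t, 1)) :
    (∀ y ∈ convexHull ℚ (T : Set (Fin d → ℚ)), 0 ≤ f (y, 1)) ∧
    (∀ y, y ∈ convexHull ℚ (Zσ (sgnS (liftS T) f)) ↔
      y ∈ convexHull ℚ (T : Set (Fin d → ℚ)) ∧ f (y, 1) = 0) := by
  set Z := Zσ (sgnS (liftS T) f) with hZ
  have h1 : convexHull ℚ (T : Set (Fin d → ℚ)) ⊆
      {y | 0 ≤ f (y, 1) ∧ (f (y, 1) = 0 → y ∈ convexHull ℚ Z)} := by
    apply convexHull_min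
    · intro t ht
      refine ⟨hf t ht, fun h => subset_convexHull _ _ ?_⟩
      exact mem_Z.2 ⟨ht, h⟩
    · intro y hy z hz a b ha hb hab
      obtain ⟨hy1, hy2⟩ := hy
      obtain ⟨hz1, hz2⟩ := hz
      have e := flin f y z hab
      have p1 := mul_nonneg ha hy1
      have p2 := mul_nonneg hb hz1
      refine ⟨by rw [e]; linarith, ?_⟩
      intro h
      rw [e] at h
      have q1 : a * f (y, 1) = 0 := by linarith
      have q2 : b * f (z, 1) = 0 := by linarith
      rcases mul_eq_zero.1 q1 with h1 | h1
      · have hb1 : b = 1 := by linarith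
        subst h1; subst hb1
        simp only [one_mul] at q2
        simpa using hz2 q2
      · rcases mul_eq_zero.1 q2 with h2 | h2
        · have hb1 : a = 1 := by linarith
          subst h2; subst hb1
          simpa using hy2 h1
        · exact convex_convexHull ℚ Z (hy2 h1) (hz2 h2) ha hb hab
  have h2 : convexHull ℚ Z ⊆ {y | y ∈ convexHull ℚ (T : Set (Fin d → ℚ)) ∧ f (y, 1) = 0} := by
    apply convexHull_min
    · intro t ht
      obtain ⟨h3, h4⟩ := mem_Z.1 ht
      exact ⟨subset_convexHull _ _ h3, h4⟩
    · intro y hy z hz a b ha hb hab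
      refine ⟨convex_convexHull ℚ _ hy.1 hz.1 ha hb hab, ?_⟩
      rw [flin f y z hab, hy.2, hz.2]
      simp
  exact ⟨fun y hy => (h1 hy).1, fun y => ⟨fun hy => h2 hy, fun hy => (h1 hy.1).2 hy.2⟩⟩

lemma finrank_lift (Z : Set (Fin d → ℚ)) (hZ : Z.Nonempty) :
    Module.finrank ℚ (Submodule.span ℚ ((fun t => (t, (1 : ℚ))) '' Z)) =
      Module.finrank ℚ (vectorSpan ℚ Z) + 1 := by
  obtain ⟨z0, hz0⟩ := hZ
  have hinj : Function.Injective (LinearMap.inl ℚ (Fin d → ℚ) ℚ) := LinearMap.inl_injective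
  rw [← ((vectorSpan ℚ Z).equivMapOfInjective _ hinj).finrank_eq.symm]
  have hnot : ((z0, 1) : (Fin d → ℚ) × ℚ) ∉
      (vectorSpan ℚ Z).map (LinearMap.inl ℚ (Fin d → ℚ) ℚ) := by
    rintro ⟨y, -, hy⟩
    have := congrArg Prod.snd hy
    simp at this
  rw [← Submodule.finrank_sup_span_singleton hnot]
  have hsp : Submodule.span ℚ ((fun t => (t, (1 : ℚ))) '' Z) =
      (vectorSpan ℚ Z).map (LinearMap.inl ℚ (Fin d → ℚ) ℚ) ⊔ Submodule.span ℚ {(z0, 1)} := by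
    apply le_antisymm
    · rw [Submodule.span_le]
      rintro _ ⟨t, ht, rfl⟩
      have : ((t, 1) : (Fin d → ℚ) × ℚ) = LinearMap.inl ℚ (Fin d → ℚ) ℚ (t - z0) + (z0, 1) := by
        ext <;> simp
      simp only [this]
      apply Submodule.add_mem_sup
      · exact Submodule.mem_map_of_mem (vsub_mem_vectorSpan ℚ ht hz0)
      · exact Submodule.mem_span_singleton_self _
    · rw [sup_le_iff]
      constructor
      · rw [vectorSpan_eq_span_vsub_set_right ℚ hz0, Submodule.map_span, Submodule.span_le]
        rintro _ ⟨_, ⟨t, ht, rfl⟩, rfl⟩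
        have : LinearMap.inl ℚ (Fin d → ℚ) ℚ (t -ᵥ z0) = (t, 1) - (z0, 1) := by
          ext <;> simp
        simp only [this]
        apply Submodule.sub_mem
        · exact Submodule.subset_span ⟨t, ht, rfl⟩
        · exact Submodule.subset_span ⟨z0, hz0, rfl⟩
      · rw [Submodule.span_singleton_le_iff_mem]
        exact Submodule.subset_span ⟨z0, hz0, rfl⟩
  rw [hsp]

lemma zero_set_eq {T : Finset (Fin d → ℚ)} (f : Module.Dual ℚ ((Fin d → ℚ) × ℚ)) :
    {v | sgnS (liftS T) f v = 0} = (fun t => (t, (1 : ℚ))) '' Zσ (sgnS (liftS T) f) := by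
  ext v
  constructor
  · intro hv
    have hvS : v ∈ liftS T := by
      by_contra h
      simp [sgnS, h] at hv
    obtain ⟨t, ht, rfl⟩ := Finset.mem_image.1 hvS
    exact ⟨t, hv, rfl⟩
  · rintro ⟨t, ht, rfl⟩
    exact ht

lemma rk_eq {T : Finset (Fin d → ℚ)} (f : Module.Dual ℚ ((Fin d → ℚ) × ℚ))
    (hZ : (Zσ (sgnS (liftS T) f)).Nonempty) :
    rkσ (sgnS (liftS T) f) = faceDim (convexHull ℚ (Zσ (sgnS (liftS T) f))) + 1 := by
  unfold rkσ faceDim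
  rw [zero_set_eq, finrank_lift _ hZ, affineSpan_convexHull, direction_affineSpan]

lemma cond_farkas {T : Finset (Fin d → ℚ)} (g : Module.Dual ℚ ((Fin d → ℚ) × ℚ))
    (hg : ∀ t ∈ T, 0 ≤ g (t, 1)) (x : Fin d → ℚ)
    (hx : ∀ f, sgnS (liftS T) f = sgnS (liftS T) g → 0 ≤ f (x, 1)) :
    ∃ w w' : (Fin d → ℚ) → ℚ, (∀ t, 0 ≤ w t) ∧ (∀ t, 0 ≤ w' t) ∧
      x = ∑ t ∈ T, w t • t - ∑ t ∈ T.filter (fun t => g (t, 1) = 0), w' t • t ∧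
      1 = ∑ t ∈ T, w t - ∑ t ∈ T.filter (fun t => g (t, 1) = 0), w' t := by
  rcases farkas (T.disjSum (T.filter (fun t => g (t, 1) = 0)))
    (Sum.elim (fun t => (t, (1 : ℚ))) (fun t => -(t, (1 : ℚ)))) (x, (1 : ℚ)) with
    ⟨w, hw, e⟩ | ⟨f, hf, hfx⟩
  · refine ⟨fun t => w (Sum.inl t), fun t => w (Sum.inr t), fun t => hw _, fun t => hw _, ?_, ?_⟩
    · have := congrArg Prod.fst e
      rw [Finset.sum_disjSum] at this
      simp only [Sum.elim_inl, Sum.elim_inr, smul_neg, Finset.sum_neg_distrib, Prod.fst_add,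
        Prod.fst_neg, Prod.fst_sum, Prod.smul_fst] at this
      rw [sub_eq_add_neg]
      exact this
    · have := congrArg Prod.snd e
      rw [Finset.sum_disjSum] at this
      simp only [Sum.elim_inl, Sum.elim_inr, smul_neg, Finset.sum_neg_distrib, Prod.snd_add,
        Prod.snd_neg, Prod.snd_sum, Prod.smul_snd, smul_eq_mul, mul_one] at this
      rw [sub_eq_add_neg]
      exact this
  · exfalso
    have hf1 : ∀ t ∈ T, 0 ≤ f (t, 1) := by
      intro t ht
      simpa using hf (Sum.inl t) (by simpa using ht)
    have hf2 : ∀ t ∈ T, g (t, 1) = 0 → f (t, 1) = 0 := by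
      intro t ht h0
      have := hf (Sum.inr t) (by simp [ht, h0])
      simp only [Sum.elim_inr, map_neg] at this
      linarith [hf1 t ht]
    set N : ℚ := (|g (x, 1)| + 1) / (- f (x, 1)) with hN
    have hN0 : 0 < N := div_pos (by positivity) (by linarith)
    have := hx (g + N • f) ?_
    · simp only [LinearMap.add_apply, LinearMap.smul_apply, smul_eq_mul] at this
      have e : N * f (x, 1) = - (|g (x, 1)| + 1) := by
        have hne : f (x, 1) ≠ 0 := hfx.ne
        rw [hN, div_neg, neg_mul, div_mul_cancel₀ _ hne]
      rw [e] at this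
      linarith [le_abs_self (g (x, 1))]
    · funext v
      by_cases hv : v ∈ liftS T
      · obtain ⟨t, ht, rfl⟩ := Finset.mem_image.1 hv
        rw [sgn_lift ht, sgn_lift ht]
        simp only [LinearMap.add_apply, LinearMap.smul_apply, smul_eq_mul]
        rcases (hg t ht).eq_or_lt with h | h
        · rw [hf2 t ht h.symm]; simp
        · rw [sign_pos h, sign_pos]
          have := mul_nonneg hN0.le (hf1 t ht)
          linarith
      · simp [sgnS, hv]

lemma mem_hull_of_weights {T : Finset (Fin d → ℚ)} (w : (Fin d → ℚ) → ℚ)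
    (h0 : ∀ t ∈ T, 0 ≤ w t) (h1 : ∑ t ∈ T, w t = 1) :
    ∑ t ∈ T, w t • t ∈ convexHull ℚ (T : Set (Fin d → ℚ)) := by
  apply (convex_convexHull ℚ _).sum_mem h0 h1
  intro t ht
  exact subset_convexHull _ _ ht

lemma mem_P_iff {T : Finset (Fin d → ℚ)} (g : Module.Dual ℚ ((Fin d → ℚ) × ℚ))
    (hg : ∀ t ∈ T, 0 < g (t, 1)) (x : Fin d → ℚ) :
    x ∈ convexHull ℚ (T : Set (Fin d → ℚ)) ↔
      ∀ f, sgnS (liftS T) f = sgnS (liftS T) g → 0 ≤ f (x, 1) := by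
  constructor
  · intro hx f hf
    refine (convZ ?_).1 x hx
    rw [← nn_iff, hf, nn_iff]
    exact fun t ht => (hg t ht).le
  · intro h
    obtain ⟨w, w', hw, hw', e1, e2⟩ := cond_farkas g (fun t ht => (hg t ht).le) x h
    have hempty : T.filter (fun t => g (t, 1) = 0) = ∅ := by
      apply Finset.filter_eq_empty_iff.2
      intro t ht
      exact (hg t ht).ne'
    rw [hempty] at e1 e2
    simp only [Finset.sum_empty, sub_zero] at e1 e2
    rw [e1]
    exact mem_hull_of_weights w (fun t _ => hw t) e2.symm

lemma mem_tangent_iff {T : Finset (Fin d → ℚ)} (g : Module.Dual ℚ ((Fin d → ℚ) × ℚ))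
    (hg : ∀ t ∈ T, 0 ≤ g (t, 1)) (hZ : (Zσ (sgnS (liftS T) g)).Nonempty) (x : Fin d → ℚ) :
    x ∈ tangentCone (convexHull ℚ (T : Set (Fin d → ℚ)))
        (convexHull ℚ (Zσ (sgnS (liftS T) g))) ↔
      ∀ f, sgnS (liftS T) f = sgnS (liftS T) g → 0 ≤ f (x, 1) := by
  constructor
  · rintro ⟨u, hu, y, rfl, ε, he, hP⟩ f hf
    have hfn : ∀ t ∈ T, 0 ≤ f (t, 1) := by
      rw [← nn_iff, hf, nn_iff]; exact hg
    rw [← hf] at hu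
    have c1 := (convZ hfn).1 _ hP
    have c2 := (((convZ hfn).2 u).1 hu).2
    have e1 : ((u + ε • y, 1) : (Fin d → ℚ) × ℚ) = (u, 1) + ε • (y, 0) := by
      ext <;> simp
    have e2 : ((u + y, 1) : (Fin d → ℚ) × ℚ) = (u, 1) + (y, 0) := by
      ext <;> simp
    rw [e1, map_add, c2, zero_add, map_smul, smul_eq_mul] at c1
    rw [e2, map_add, c2, zero_add]
    exact nonneg_of_mul_nonneg_right c1 he
  · intro h
    obtain ⟨w, w', hw, hw', e1, e2⟩ := cond_farkas g hg x h
    set ZF := T.filter (fun t => g (t, 1) = 0) with hZF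
    have hZeq : Zσ (sgnS (liftS T) g) = (ZF : Set (Fin d → ℚ)) := by
      ext t
      rw [mem_Z]
      simp [hZF]
    rw [hZeq] at hZ ⊢
    have hZne : ZF.Nonempty := by simpa using hZ
    have hn : (0 : ℚ) < ZF.card := by exact_mod_cast hZne.card_pos
    set n : ℚ := (ZF.card : ℚ) with hndef
    set M : ℚ := ∑ t ∈ ZF, w' t with hM
    have hM0 : 0 ≤ M := Finset.sum_nonneg fun t _ => hw' t
    set ε : ℚ := 1 / (1 + n * M) with hε
    have hden : 0 < 1 + n * M := add_pos_of_pos_of_nonneg one_pos (mul_nonneg hn.le hM0)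
    have he : 0 < ε := one_div_pos.2 hden
    have hsum1 : ∑ t ∈ ZF, (1 / n : ℚ) = 1 := by
      rw [Finset.sum_const, nsmul_eq_mul]
      field_simp
      rw [hndef]
    set u : Fin d → ℚ := ∑ t ∈ ZF, (1 / n : ℚ) • t with hu
    refine ⟨u, ?_, x - u, by abel, ε, he, ?_⟩
    · exact mem_hull_of_weights (fun _ => 1 / n) (fun t _ => (one_div_pos.2 hn).le) hsum1
    · have hc : ∀ t ∈ ZF, 0 ≤ (1 - ε) * (1 / n) - ε * w' t := by
        intro t ht
        have hle : w' t ≤ M := Finset.single_le_sum (f := w') (fun i _ => hw' i) ht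
        have h1 : (1 - ε) * (1 / n) - ε * w' t = ε * (M - w' t) := by
          rw [hε]; field_simp; ring
        rw [h1]
        exact mul_nonneg he.le (by linarith)
      have key : u + ε • (x - u) = ∑ t ∈ T, (ε * w t +
          (if g (t, 1) = 0 then (1 - ε) * (1 / n) - ε * w' t else 0)) • t := by
        simp only [add_smul, Finset.sum_add_distrib, ite_smul, zero_smul]
        rw [← Finset.sum_filter]
        simp only [sub_smul, Finset.sum_sub_distrib, mul_smul, ← Finset.smul_sum]
        rw [← hZF, e1]
        simp only [hu, Finset.smul_sum, smul_sub]
        simp only [sub_smul, one_smul, Finset.sum_sub_distrib]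
        abel
      rw [key]
      apply mem_hull_of_weights
      · intro t ht
        have := mul_nonneg he.le (hw t)
        split_ifs with hz
        · have := hc t (Finset.mem_filter.2 ⟨ht, hz⟩)
          linarith
        · linarith
      · rw [Finset.sum_add_distrib, ← Finset.sum_filter, Finset.sum_sub_distrib,
          ← Finset.mul_sum, ← Finset.mul_sum, ← Finset.mul_sum, ← hZF, hsum1]
        have : ∑ t ∈ T, w t = 1 + M := by linarith
        rw [this]
        ring

end BG2

/-- **Brianchon–Gram formula**: the indicator function of a full-dimensional
polytope is the alternating sum of the indicator functions of the tangent cones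
at all nonempty faces. -/
theorem brianchon_gram {d : ℕ} (hd : 1 ≤ d) (P : Set (Fin d → ℚ))
    (hP : IsPolytope P) (hfull : affineSpan ℚ P = ⊤) :
    ∀ x : Fin d → ℚ,
      indicator P x =
        ∑ᶠ F ∈ {F : Set (Fin d → ℚ) | IsFace P F ∧ F.Nonempty},
          (-1 : ℤ) ^ faceDim F * indicator (tangentCone P F) x := by
  obtain ⟨T, rfl⟩ := hP
  intro x
  let f0 : Module.Dual ℚ ((Fin d → ℚ) × ℚ) := LinearMap.snd ℚ (Fin d → ℚ) ℚ
  have h0 : ∀ v ∈ liftS T, f0 v = 1 := by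
    intro v hv
    obtain ⟨t, ht, rfl⟩ := Finset.mem_image.1 hv
    rfl
  have hsum := sum_vanish (liftS T) (x, 1) f0 h0 rfl
  set one := sgnS (liftS T) f0 with hone
  have hone1 : ∀ v, one v = 1 := by
    intro v
    by_cases hv : v ∈ liftS T
    · simp [hone, sgnS, hv, h0 v hv]
    · simp [hone, sgnS, hv]
  have honemem : one ∈ cellsF (liftS T) := mem_cellsF.2 ⟨f0, rfl⟩
  set 𝒵 := (cellsF (liftS T)).filter
    (fun σ => (∀ v ∈ liftS T, σ v ≠ -1) ∧ (Zσ σ).Nonempty) with h𝒵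
  have hbij : Set.BijOn (fun σ => convexHull ℚ (Zσ σ)) (𝒵 : Set ((Fin d → ℚ) × ℚ → SignType))
      {F : Set (Fin d → ℚ) | IsFace (convexHull ℚ (T : Set (Fin d → ℚ))) F ∧ F.Nonempty} := by
    refine ⟨?_, ?_, ?_⟩
    · intro σ hσ
      obtain ⟨hc, hn, hz⟩ := Finset.mem_filter.1 (Finset.mem_coe.1 hσ)
      obtain ⟨f, rfl⟩ := mem_cellsF.1 hc
      have hf := nn_iff.1 hn
      obtain ⟨c1, c2⟩ := convZ hf
      refine ⟨⟨-(f.comp (LinearMap.inl ℚ (Fin d → ℚ) ℚ)), ?_⟩, hz.convexHull⟩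
      have hl : ∀ y, (-(f.comp (LinearMap.inl ℚ (Fin d → ℚ) ℚ))) y = f (0, 1) - f (y, 1) := by
        intro y
        have : ((y, 1) : (Fin d → ℚ) × ℚ) = (y, 0) + (0, 1) := by ext <;> simp
        rw [this, map_add]
        simp
      ext y
      simp only [c2 y, Set.mem_ofPred_eq, hl]
      constructor
      · rintro ⟨h1, h2⟩
        refine ⟨h1, fun z hz => ?_⟩
        have := c1 z hz
        linarith
      · rintro ⟨h1, h2⟩
        refine ⟨h1, ?_⟩
        obtain ⟨z, hz⟩ := hz
        obtain ⟨h3, h4⟩ := mem_Z.1 hz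
        have h5 := h2 z (subset_convexHull _ _ h3)
        have := c1 y h1
        linarith
    · intro σ hσ σ' hσ' heq
      obtain ⟨hc, hn, -⟩ := Finset.mem_filter.1 (Finset.mem_coe.1 hσ)
      obtain ⟨hc', hn', -⟩ := Finset.mem_filter.1 (Finset.mem_coe.1 hσ')
      obtain ⟨f, rfl⟩ := mem_cellsF.1 hc
      obtain ⟨f', rfl⟩ := mem_cellsF.1 hc'
      have hf := nn_iff.1 hn
      have hf' := nn_iff.1 hn'
      have hiff : ∀ t ∈ T, f (t, 1) = 0 ↔ f' (t, 1) = 0 := by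
        intro t ht
        have htP := subset_convexHull ℚ (T : Set (Fin d → ℚ)) ht
        have e1 := (convZ hf).2 t
        have e2 := (convZ hf').2 t
        simp only at heq
        rw [heq] at e1
        constructor
        · intro h; exact (e2.1 (e1.2 ⟨htP, h⟩)).2
        · intro h; exact (e1.1 (e2.2 ⟨htP, h⟩)).2
      funext v
      by_cases hv : v ∈ liftS T
      · obtain ⟨t, ht, rfl⟩ := Finset.mem_image.1 hv
        rw [sgn_lift ht, sgn_lift ht]
        by_cases h : f (t, 1) = 0
        · rw [h, (hiff t ht).1 h]
        · have h' : f' (t, 1) ≠ 0 := fun h' => h ((hiff t ht).2 h')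
          rw [sign_pos (lt_of_le_of_ne (hf t ht) (Ne.symm h)),
            sign_pos (lt_of_le_of_ne (hf' t ht) (Ne.symm h'))]
      · simp [sgnS, hv]
    · rintro F ⟨⟨ℓ, rfl⟩, ⟨m, hm⟩⟩
      obtain ⟨hmP, hmax⟩ := hm
      let f : Module.Dual ℚ ((Fin d → ℚ) × ℚ) :=
        (ℓ m) • LinearMap.snd ℚ (Fin d → ℚ) ℚ - ℓ.comp (LinearMap.fst ℚ (Fin d → ℚ) ℚ)
      have hfv : ∀ y, f (y, 1) = ℓ m - ℓ y := by
        intro y; simp [f]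
      have hf : ∀ t ∈ T, 0 ≤ f (t, 1) := by
        intro t ht
        rw [hfv]
        linarith [hmax t (subset_convexHull _ _ ht)]
      have c2 := (convZ hf).2
      have hmem : m ∈ convexHull ℚ (Zσ (sgnS (liftS T) f)) :=
        (c2 m).2 ⟨hmP, by rw [hfv]; ring⟩
      refine ⟨sgnS (liftS T) f, ?_, ?_⟩
      · apply Finset.mem_coe.2
        apply Finset.mem_filter.2
        refine ⟨mem_cellsF.2 ⟨f, rfl⟩, nn_iff.2 hf, ?_⟩
        exact convexHull_nonempty_iff.1 ⟨m, hmem⟩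
      · ext y
        simp only [c2 y, Set.mem_ofPred_eq, hfv]
        constructor
        · rintro ⟨h1, h2⟩
          refine ⟨h1, fun z hz => ?_⟩
          linarith [hmax z hz]
        · rintro ⟨h1, h2⟩
          refine ⟨h1, ?_⟩
          linarith [hmax y h1, h2 m hmP]
  have hval : ∀ σ ∈ (𝒵 : Set ((Fin d → ℚ) × ℚ → SignType)),
      (-(if (∀ v ∈ liftS T, σ v ≠ -1) ∧ (∀ f, sgnS (liftS T) f = σ → 0 ≤ f (x, 1))
        then (-1 : ℤ) ^ rkσ σ else 0)) =
      (-1 : ℤ) ^ faceDim (convexHull ℚ (Zσ σ)) *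
        indicator (tangentCone (convexHull ℚ (T : Set (Fin d → ℚ))) (convexHull ℚ (Zσ σ))) x := by
    intro σ hσ
    obtain ⟨hc, hn, hz⟩ := Finset.mem_filter.1 (Finset.mem_coe.1 hσ)
    obtain ⟨f, rfl⟩ := mem_cellsF.1 hc
    unfold indicator
    rw [rk_eq f hz]
    simp only [mem_tangent_iff f (nn_iff.1 hn) hz x, eq_true hn, true_and]
    split_ifs
    · ring
    · ring
  rw [← finsum_mem_eq_of_bijOn _ hbij hval, finsum_mem_coe_finset, Finset.sum_neg_distrib]
  have hsplit := hsum
  rw [← Finset.sum_erase_add _ _ honemem] at hsplit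
  have hrest : ∑ σ ∈ (cellsF (liftS T)).erase one,
      (if (∀ v ∈ liftS T, σ v ≠ -1) ∧ (∀ f, sgnS (liftS T) f = σ → 0 ≤ f (x, 1))
        then (-1 : ℤ) ^ rkσ σ else 0) = ∑ σ ∈ 𝒵,
      (if (∀ v ∈ liftS T, σ v ≠ -1) ∧ (∀ f, sgnS (liftS T) f = σ → 0 ≤ f (x, 1))
        then (-1 : ℤ) ^ rkσ σ else 0) := by
    symm
    apply Finset.sum_subset
    · intro σ hσ
      obtain ⟨hc, hn, ⟨t, ht⟩⟩ := Finset.mem_filter.1 hσ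
      refine Finset.mem_erase.2 ⟨?_, hc⟩
      rintro rfl
      have h1 : one (t, 1) = 0 := ht
      rw [hone1] at h1
      exact absurd h1 (by decide)
    · intro σ hσ hnot
      obtain ⟨hne, hc⟩ := Finset.mem_erase.1 hσ
      apply if_neg
      rintro ⟨hn, -⟩
      have hz : ¬ (Zσ σ).Nonempty := fun hz => hnot (Finset.mem_filter.2 ⟨hc, hn, hz⟩)
      apply hne
      funext v
      rw [hone1]
      by_cases hv : v ∈ liftS T
      · have h1 := hn v hv
        have h2 : σ v ≠ 0 := by
          intro h
          obtain ⟨t, ht, rfl⟩ := Finset.mem_image.1 hv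
          exact hz ⟨t, h⟩
        revert h1 h2
        generalize σ v = s
        revert s
        decide
      · exact cell_out hc hv
  rw [hrest] at hsplit
  have hlast : (if (∀ v ∈ liftS T, one v ≠ -1) ∧ (∀ f, sgnS (liftS T) f = one → 0 ≤ f (x, 1))
        then (-1 : ℤ) ^ rkσ one else 0) = indicator (convexHull ℚ (T : Set (Fin d → ℚ))) x := by
    have hn : ∀ v ∈ liftS T, one v ≠ -1 := by
      intro v _
      rw [hone1]
      decide
    have hr : rkσ one = 0 := by
      unfold rkσ
      have : {v | one v = 0} = ∅ := by
        ext v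
        simp [hone1]
      rw [this, Submodule.span_empty, finrank_bot]
    unfold indicator
    have hpos : ∀ t ∈ T, 0 < f0 (t, 1) := by
      intro t _
      exact one_pos
    rw [hr]
    simp only [mem_P_iff f0 hpos x, eq_true hn, true_and, pow_zero]
    rfl
  rw [hlast] at hsplit
  linarith
end
end

section
/- Brion's theorem, indicator-function version: For every full-dimensional polytope P ⊆ ℚ^d, the function 1_P − Σ_{v vertex of P} 1_{T_v P} is a finite integer linear combination of indicator functions of convex cones each of which contains an affine line; i.e., there exist finitely many convex cones K_1,…,K_m ⊆ ℚ^d, each containing an affine line, and integers c_1,…,c_m with 1_P − Σ_v 1_{T_v P} = Σ_j c_j · 1_{K_j}. -/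
noncomputable section
open Classical

open scoped BigOperators

/-- A vertex is a point whose singleton is a face. -/
def IsVertex {d : ℕ} (P : Set (Fin d → ℚ)) (v : Fin d → ℚ) : Prop :=
  IsFace P {v}

/-- `K` is a convex cone with apex `a`. -/
def IsConvexConeAt {d : ℕ} (a : Fin d → ℚ) (K : Set (Fin d → ℚ)) : Prop :=
  Convex ℚ K ∧ ∀ x ∈ K, ∀ lam : ℚ, 0 < lam → a + lam • (x - a) ∈ K

/-- `K` contains an affine line. -/
def ContainsLine {d : ℕ} (K : Set (Fin d → ℚ)) : Prop :=
  ∃ x ∈ K, ∃ t : Fin d → ℚ, t ≠ 0 ∧ ∀ lam : ℚ, x + lam • t ∈ K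

/-- Berge-type intersection lemma for coordinate halfspaces. -/
theorem berge_aux {ι : Type*} (T : Finset ι) : ∀ (A : Set (ι → ℚ)), Convex ℚ A → T.Nonempty →
    (∀ u ∈ T, ∃ p ∈ A, ∀ t ∈ T, t ≠ u → p t < 0) →
    (∀ w ∈ A, ∃ t ∈ T, 0 ≤ w t) → ∃ w ∈ A, ∀ t ∈ T, 0 ≤ w t := by
  induction T using Finset.induction_on with
  | empty => intro A _ h; simp at h
  | insert a T ha ih =>
    intro A hA _ hp hc
    obtain ⟨pa, hpa, hpa'⟩ := hp a (Finset.mem_insert_self _ _)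
    have hneg : ∀ t ∈ T, pa t < 0 := fun t ht =>
      hpa' t (Finset.mem_insert_of_mem ht) (fun h => ha (h ▸ ht))
    have hpa0 : 0 ≤ pa a := by
      obtain ⟨t, ht, h⟩ := hc pa hpa
      rcases Finset.mem_insert.1 ht with rfl | ht
      · exact h
      · exact absurd h (not_le.2 (hneg t ht))
    rcases T.eq_empty_or_nonempty with rfl | hT
    · exact ⟨pa, hpa, by simpa using hpa0⟩
    have hp2 : ∀ u ∈ T, ∃ p ∈ A, p a < 0 ∧ ∀ t ∈ T, t ≠ u → p t < 0 := by
      intro u hu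
      obtain ⟨p, hpA, h⟩ := hp u (Finset.mem_insert_of_mem hu)
      exact ⟨p, hpA, h a (Finset.mem_insert_self _ _) (fun h => ha (h ▸ hu)),
        fun t ht => h t (Finset.mem_insert_of_mem ht)⟩
    have hconv : Convex ℚ (A ∩ {w | w a = 0}) := by
      refine hA.inter ?_
      intro x hx y hy s t _ _ _
      simp only [Set.mem_ofPred_eq] at *
      simp [hx, hy]
    obtain ⟨w, ⟨hwA, hw0⟩, hw⟩ := ih (A ∩ {w | w a = 0}) hconv hT (by
      intro u hu
      obtain ⟨p, hpA, h0, h⟩ := hp2 u hu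
      have hs : 0 < pa a - p a := by linarith
      refine ⟨(-(p a) / (pa a - p a)) • pa + (pa a / (pa a - p a)) • p,
        ⟨hA hpa hpA (div_nonneg (by linarith) hs.le) (div_nonneg hpa0 hs.le) (by field_simp; ring),
          ?_⟩, ?_⟩
      · simp only [Set.mem_ofPred_eq, Pi.add_apply, Pi.smul_apply, smul_eq_mul]; field_simp; ring
      · intro t ht htu
        simp only [Pi.add_apply, Pi.smul_apply, smul_eq_mul]
        have h1 := mul_neg_of_pos_of_neg (div_pos (neg_pos.2 h0) hs) (hneg t ht)
        have h2 := mul_nonpos_of_nonneg_of_nonpos (div_nonneg hpa0 hs.le) (h t ht htu).le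
        linarith) (by
      rintro w ⟨hwA, hw0⟩
      simp only [Set.mem_ofPred_eq] at hw0
      by_contra hcon
      push Not at hcon
      obtain ⟨u, hu⟩ := hT
      obtain ⟨p, hpA, h0, h⟩ := hp2 u hu
      have key : ∃ e : ℚ, 0 < e ∧ e ≤ 1 ∧ (1 - e) * w u + e * p u < 0 := by
        have hwu := hcon u hu
        have hd : 0 < -w u + |p u| + 1 := by linarith [abs_nonneg (p u)]
        refine ⟨(-w u) / (2 * (-w u + |p u| + 1)), by apply div_pos <;> linarith, ?_, ?_⟩
        · rw [div_le_one (by linarith)]; linarith [abs_nonneg (p u)]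
        · set e := (-w u) / (2 * (-w u + |p u| + 1)) with he
          have e0 : 0 < e := by apply div_pos <;> linarith
          have h1 : e * (-w u + |p u| + 1) = (-w u) / 2 := by rw [he]; field_simp
          nlinarith [mul_le_mul_of_nonneg_left (le_abs_self (p u)) e0.le]
      obtain ⟨e, e0, e1, he⟩ := key
      obtain ⟨t, ht, h'⟩ := hc _ (hA hwA hpA (sub_nonneg.2 e1) e0.le (by ring))
      simp only [Pi.add_apply, Pi.smul_apply, smul_eq_mul] at h'
      rcases Finset.mem_insert.1 ht with rfl | ht
      · rw [hw0] at h'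
        nlinarith
      · by_cases htu : t = u
        · subst htu; linarith
        · have := hcon t ht
          have := h t ht htu
          nlinarith [mul_nonneg (sub_nonneg.2 e1) (neg_nonneg.2 (hcon t ht).le)])
    refine ⟨w, hwA, fun t ht => ?_⟩
    rcases Finset.mem_insert.1 ht with rfl | ht
    · exact (show w _ = 0 from hw0).ge
    · exact hw t ht

theorem nerve_aux {ι : Type*} (n : ℕ) : ∀ (T : Finset ι), T.card = n → ∀ (A : Set (ι → ℚ)),
    Convex ℚ A → (∀ w ∈ A, ∃ t ∈ T, 0 ≤ w t) →
    ∑ F ∈ T.powerset, (-1 : ℤ) ^ F.card *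
      (if ∃ w ∈ A, ∀ t ∈ T, t ∉ F → 0 ≤ w t then 1 else 0) = 0 := by
  induction n with
  | zero =>
    intro T hT A hA hc
    rw [Finset.card_eq_zero] at hT
    subst hT
    have : ¬ ∃ w, w ∈ A := by rintro ⟨w, hw⟩; simpa using hc w hw
    simp [this]
  | succ n ih =>
    intro T hT A hA hc
    by_cases hmin : ∀ u ∈ T, ∃ p ∈ A, ∀ t ∈ T, t ≠ u → p t < 0
    · have hne : T.Nonempty := Finset.card_pos.1 (by omega)
      obtain ⟨w, hw, h⟩ := berge_aux T A hA hne hmin hc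
      have : ∀ F ∈ T.powerset, (-1 : ℤ) ^ F.card *
          (if ∃ w ∈ A, ∀ t ∈ T, t ∉ F → 0 ≤ w t then 1 else 0) = (-1) ^ F.card := by
        intro F _
        rw [if_pos ⟨w, hw, fun t ht _ => h t ht⟩, mul_one]
      rw [Finset.sum_congr rfl this]
      exact Finset.sum_powerset_neg_one_pow_card_of_nonempty hne
    · push Not at hmin
      obtain ⟨u, hu, hcov⟩ := hmin
      obtain ⟨T', hu', rfl⟩ : ∃ T', u ∉ T' ∧ insert u T' = T :=
        ⟨T.erase u, Finset.notMem_erase _ _, Finset.insert_erase hu⟩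
      have hcard : T'.card = n := by
        rw [Finset.card_insert_of_notMem hu'] at hT; omega
      have hcov' : ∀ w ∈ A, ∃ t ∈ T', 0 ≤ w t := by
        intro w hw
        obtain ⟨t, ht, htu, h⟩ := hcov w hw
        exact ⟨t, (Finset.mem_insert.1 ht).resolve_left htu, h⟩
      rw [Finset.sum_powerset_insert hu']
      have hconv : Convex ℚ (A ∩ {w | 0 ≤ w u}) := by
        refine hA.inter ?_
        intro x hx y hy s t hs ht _
        simp only [Set.mem_ofPred_eq] at *
        simp only [Pi.add_apply, Pi.smul_apply, smul_eq_mul]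
        positivity
      have e1 := ih T' hcard A hA hcov'
      have e2 := ih T' hcard _ hconv (fun w hw => hcov' w hw.1)
      have f1 : ∀ F ∈ T'.powerset, (-1 : ℤ) ^ F.card *
          (if ∃ w ∈ A, ∀ t ∈ insert u T', t ∉ F → 0 ≤ w t then 1 else 0) =
          (-1 : ℤ) ^ F.card *
          (if ∃ w ∈ A ∩ {w | 0 ≤ w u}, ∀ t ∈ T', t ∉ F → 0 ≤ w t then 1 else 0) := by
        intro F hF
        have huF : u ∉ F := fun h => hu' (Finset.mem_powerset.1 hF h)
        congr 1
        refine if_congr ?_ rfl rfl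
        constructor
        · rintro ⟨w, hw, h⟩
          exact ⟨w, ⟨hw, h u (Finset.mem_insert_self _ _) huF⟩,
            fun t ht => h t (Finset.mem_insert_of_mem ht)⟩
        · rintro ⟨w, ⟨hw, h0⟩, h⟩
          refine ⟨w, hw, fun t ht htF => ?_⟩
          rcases Finset.mem_insert.1 ht with rfl | ht
          · exact h0
          · exact h t ht htF
      have f2 : ∀ F ∈ T'.powerset, (-1 : ℤ) ^ (insert u F).card *
          (if ∃ w ∈ A, ∀ t ∈ insert u T', t ∉ insert u F → 0 ≤ w t then 1 else 0) =
          - ((-1 : ℤ) ^ F.card *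
          (if ∃ w ∈ A, ∀ t ∈ T', t ∉ F → 0 ≤ w t then 1 else 0)) := by
        intro F hF
        have huF : u ∉ F := fun h => hu' (Finset.mem_powerset.1 hF h)
        rw [Finset.card_insert_of_notMem huF, pow_succ, mul_neg_one, neg_mul]
        congr 2
        refine if_congr ?_ rfl rfl
        constructor
        · rintro ⟨w, hw, h⟩
          refine ⟨w, hw, fun t ht htF => h t (Finset.mem_insert_of_mem ht) ?_⟩
          rw [Finset.mem_insert]
          rintro (rfl | h)
          · exact hu' ht
          · exact htF h
        · rintro ⟨w, hw, h⟩
          refine ⟨w, hw, fun t ht htF => ?_⟩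
          rw [Finset.mem_insert, not_or] at htF
          exact h t ((Finset.mem_insert.1 ht).resolve_left htF.1) htF.2
      rw [Finset.sum_congr rfl f1, Finset.sum_congr rfl f2, Finset.sum_neg_distrib, e1, e2]
      simp

/-- Gordan's alternative over `ℚ`, relative to a subspace. -/
theorem gordan_aux {V : Type*} [AddCommGroup V] [Module ℚ V] (W : Finset V) :
    ∀ U : Submodule ℚ V, (∃ l : Module.Dual ℚ V, (∀ u ∈ U, l u = 0) ∧ ∀ w ∈ W, l w < 0) ∨
      (∃ c : V → ℚ, (∀ w ∈ W, 0 ≤ c w) ∧ (∃ w ∈ W, 0 < c w) ∧ ∑ w ∈ W, c w • w ∈ U) := by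
  induction W using Finset.induction_on with
  | empty => intro U; left; exact ⟨0, by simp, by simp⟩
  | insert a W ha ih =>
    intro U
    have hsum : ∀ (c : V → ℚ) (r : ℚ), ∑ w ∈ insert a W, (if w = a then r else c w) • w
        = r • a + ∑ w ∈ W, c w • w := by
      intro c r
      rw [Finset.sum_insert ha, if_pos rfl]
      congr 1
      refine Finset.sum_congr rfl fun w hw => ?_
      rw [if_neg (by rintro rfl; exact ha hw)]
    by_cases haU : a ∈ U
    · right
      refine ⟨fun w => if w = a then 1 else 0, fun w _ => by dsimp only; split_ifs <;> norm_num,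
        ⟨a, Finset.mem_insert_self _ _, by simp⟩, ?_⟩
      have := hsum (fun _ => 0) 1
      rw [this]
      simpa using haU
    rcases ih U with ⟨l, hlU, hl⟩ | ⟨c, hc, ⟨w, hw, hcw⟩, hcU⟩
    swap
    · right
      refine ⟨fun w => if w = a then 0 else c w, fun w hw => ?_,
        ⟨w, Finset.mem_insert_of_mem hw, ?_⟩, ?_⟩
      · dsimp only
        split_ifs with h
        · exact le_rfl
        · exact hc w ((Finset.mem_insert.1 hw).resolve_left h)
      · dsimp only
        rw [if_neg (by rintro rfl; exact ha hw)]; exact hcw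
      · rw [hsum]; simpa using hcU
    rcases ih (U ⊔ Submodule.span ℚ {a}) with ⟨l', hl'U, hl'⟩ | ⟨c, hc, ⟨w, hw, hcw⟩, hcU⟩
    · left
      obtain ⟨l0, hl0a, hl0U⟩ : ∃ l0 : Module.Dual ℚ V, l0 a < 0 ∧ ∀ u ∈ U, l0 u = 0 := by
        obtain ⟨f, hf, hfU⟩ := Submodule.exists_le_ker_of_notMem haU
        refine ⟨(-(f a)⁻¹) • f, ?_, fun u hu => ?_⟩
        · simp [hf]
        · have : f u = 0 := hfU hu
          simp [this]
      have hl'a : l' a = 0 := hl'U a (Submodule.mem_sup_right (Submodule.mem_span_singleton_self a))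
      have hN : ∃ N : ℚ, 0 < N ∧ ∀ w ∈ W, l0 w + N * l' w < 0 := by
        clear hsum ih hl hl0U hlU
        induction W using Finset.induction_on with
        | empty => exact ⟨1, one_pos, by simp⟩
        | insert b W hb ihW =>
          obtain ⟨N, hN0, hN⟩ := ihW (fun h => ha (Finset.mem_insert_of_mem h))
            (fun w hw => hl' w (Finset.mem_insert_of_mem hw))
          have hb' := hl' b (Finset.mem_insert_self _ _)
          refine ⟨N + (|l0 b| + 1) / (- l' b), ?_, fun w hw => ?_⟩
          · have : 0 < - l' b := by linarith
            positivity
          · have hpos : 0 < (|l0 b| + 1) / (- l' b) := by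
              have : 0 < - l' b := by linarith
              positivity
            rcases Finset.mem_insert.1 hw with rfl | hw
            · have h1 : (|l0 w| + 1) / (- l' w) * l' w = -(|l0 w| + 1) := by
                have : l' w ≠ 0 := hb'.ne
                field_simp
              nlinarith [le_abs_self (l0 w)]
            · have := hN w hw
              have := hl' w (Finset.mem_insert_of_mem hw)
              nlinarith
      obtain ⟨N, hN0, hN⟩ := hN
      refine ⟨l0 + N • l', fun u hu => ?_, fun w hw => ?_⟩
      · simp [hl0U u hu, hl'U u (Submodule.mem_sup_left hu)]
      · simp only [LinearMap.add_apply, LinearMap.smul_apply, smul_eq_mul]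
        rcases Finset.mem_insert.1 hw with rfl | hw
        · rw [hl'a]; linarith
        · exact hN w hw
    · obtain ⟨u, hu, v, hv, huv⟩ := Submodule.mem_sup.1 hcU
      obtain ⟨r, rfl⟩ := Submodule.mem_span_singleton.1 hv
      by_cases hr : r ≤ 0
      · right
        refine ⟨fun w => if w = a then -r else c w, fun w hw => ?_,
          ⟨w, Finset.mem_insert_of_mem hw, ?_⟩, ?_⟩
        · dsimp only
          split_ifs with h
          · linarith
          · exact hc w ((Finset.mem_insert.1 hw).resolve_left h)
        · dsimp only
          rw [if_neg (by rintro rfl; exact ha hw)]; exact hcw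
        · rw [hsum, ← huv]
          convert hu using 1
          simp
      · left
        push Not at hr
        refine ⟨l, hlU, fun x hx => ?_⟩
        rcases Finset.mem_insert.1 hx with rfl | hx
        · have h1 : l (∑ w ∈ W, c w • w) < 0 := by
            rw [map_sum]
            have : ∑ w ∈ W, l (c w • w) < ∑ w ∈ W, (0 : ℚ) := by
              refine Finset.sum_lt_sum (fun i hi => ?_) ⟨w, hw, ?_⟩
              · rw [map_smul, smul_eq_mul]
                exact mul_nonpos_of_nonneg_of_nonpos (hc i hi) (hl i hi).le
              · rw [map_smul, smul_eq_mul]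
                exact mul_neg_of_pos_of_neg hcw (hl w hw)
            simpa using this
          rw [← huv, map_add, hlU u hu, map_smul, smul_eq_mul, zero_add] at h1
          by_contra hcon
          push Not at hcon
          nlinarith
        · exact hl x hx

/-- Affine combinations of `T` with coefficients nonnegative off `F`. -/
def coneOff {d : ℕ} (T F : Finset (Fin d → ℚ)) : Set (Fin d → ℚ) :=
  {x | ∃ w : (Fin d → ℚ) → ℚ, (∑ t ∈ T, w t = 1 ∧ ∑ t ∈ T, w t • t = x) ∧
    ∀ t ∈ T, t ∉ F → 0 ≤ w t}

theorem coneOff_sum {d : ℕ} (T : Finset (Fin d → ℚ)) (x : Fin d → ℚ) :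
    ∑ F ∈ T.powerset, (-1 : ℤ) ^ F.card * indicator (coneOff T F) x = 0 := by
  have := nerve_aux T.card T rfl
    {w : (Fin d → ℚ) → ℚ | ∑ t ∈ T, w t = 1 ∧ ∑ t ∈ T, w t • t = x} (by
      rintro w ⟨h1, h2⟩ w' ⟨h1', h2'⟩ a b ha hb hab
      constructor
      · simp only [Pi.add_apply, Pi.smul_apply, smul_eq_mul, Finset.sum_add_distrib,
          ← Finset.mul_sum, h1, h1']
        linarith
      · simp only [Pi.add_apply, Pi.smul_apply, smul_eq_mul, add_smul, mul_smul,
          Finset.sum_add_distrib, ← Finset.smul_sum, h2, h2']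
        rw [← add_smul, hab, one_smul]) (by
      rintro w ⟨h1, _⟩
      by_contra hcon
      push Not at hcon
      have := Finset.sum_nonpos (fun t ht => (hcon t ht).le)
      linarith)
  refine (Finset.sum_congr rfl fun F _ => ?_).trans this
  congr 1

theorem coneOff_empty {d : ℕ} (T : Finset (Fin d → ℚ)) :
    coneOff T ∅ = convexHull ℚ (T : Set (Fin d → ℚ)) := by
  ext x
  rw [Finset.mem_convexHull']
  simp only [coneOff, Set.mem_ofPred_eq, Finset.notMem_empty, not_false_eq_true, forall_true_left]
  constructor
  · rintro ⟨w, ⟨h1, h2⟩, h3⟩; exact ⟨w, h3, h1, h2⟩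
  · rintro ⟨w, h3, h1, h2⟩; exact ⟨w, ⟨h1, h2⟩, h3⟩

/-- Moving weights along the homothety centred at `v`. -/
theorem shift_weights {d : ℕ} {T : Finset (Fin d → ℚ)} {v : Fin d → ℚ} (hv : v ∈ T)
    {w : (Fin d → ℚ) → ℚ} {x : Fin d → ℚ} (h1 : ∑ t ∈ T, w t = 1) (h2 : ∑ t ∈ T, w t • t = x)
    (r : ℚ) : ∑ t ∈ T, (r * w t + if t = v then 1 - r else 0) = 1 ∧
      ∑ t ∈ T, (r * w t + if t = v then 1 - r else 0) • t = v + r • (x - v) := by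
  constructor
  · rw [Finset.sum_add_distrib, ← Finset.mul_sum, h1, Finset.sum_ite_eq' T v, if_pos hv]; ring
  · simp only [add_smul, mul_smul, Finset.sum_add_distrib, ← Finset.smul_sum, h2, ite_smul,
      zero_smul]
    rw [Finset.sum_ite_eq' T v, if_pos hv]
    module

theorem coneOff_cone {d : ℕ} {T F : Finset (Fin d → ℚ)} {v : Fin d → ℚ} (hv : v ∈ T)
    (hvF : v ∈ F) : IsConvexConeAt v (coneOff T F) := by
  constructor
  · rintro x ⟨w, ⟨h1, h2⟩, h3⟩ y ⟨w', ⟨h1', h2'⟩, h3'⟩ a b ha hb hab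
    refine ⟨a • w + b • w', ⟨?_, ?_⟩, ?_⟩
    · simp only [Pi.add_apply, Pi.smul_apply, smul_eq_mul, Finset.sum_add_distrib,
          ← Finset.mul_sum, h1, h1']
      linarith
    · simp only [Pi.add_apply, Pi.smul_apply, smul_eq_mul, add_smul, mul_smul,
          Finset.sum_add_distrib, ← Finset.smul_sum, h2, h2']
    · intro t ht htF
      have := h3 t ht htF
      have := h3' t ht htF
      simp only [Pi.add_apply, Pi.smul_apply, smul_eq_mul]
      positivity
  · rintro x ⟨w, ⟨h1, h2⟩, h3⟩ r hr
    refine ⟨_, shift_weights hv h1 h2 r, fun t ht htF => ?_⟩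
    rw [if_neg (by rintro rfl; exact htF hvF), add_zero]
    exact mul_nonneg hr.le (h3 t ht htF)

theorem coneOff_singleton {d : ℕ} {T : Finset (Fin d → ℚ)} {v : Fin d → ℚ} (hv : v ∈ T) :
    coneOff T {v} = tangentCone (convexHull ℚ (T : Set (Fin d → ℚ))) {v} := by
  rw [← coneOff_empty]
  ext y
  constructor
  · rintro ⟨w, ⟨h1, h2⟩, h3⟩
    have hpos : 0 < 1 + |w v| := by positivity
    refine ⟨v, rfl, y - v, by abel, (1 + |w v|)⁻¹, by positivity, _,
      shift_weights hv h1 h2 _, fun t ht _ => ?_⟩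
    split_ifs with h
    · subst h
      have : (1 + |w t|)⁻¹ * w t + (1 - (1 + |w t|)⁻¹) = (w t + |w t|) * (1 + |w t|)⁻¹ := by
        field_simp; ring
      rw [this]
      exact mul_nonneg (by linarith [neg_abs_le (w t)]) (by positivity)
    · rw [add_zero]
      exact mul_nonneg (by positivity) (h3 t ht (by simpa using h))
  · rintro ⟨f, hf, x, rfl, e, he, w, ⟨h1, h2⟩, h3⟩
    obtain rfl : f = v := hf
    have := shift_weights hv h1 h2 e⁻¹
    refine ⟨_, ⟨this.1, this.2.trans ?_⟩, fun t ht htF => ?_⟩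
    · rw [add_sub_cancel_left, smul_smul, inv_mul_cancel₀ he.ne', one_smul]
    · rw [if_neg (by simpa using htF), add_zero]
      exact mul_nonneg (by positivity) (h3 t ht (by simp))

/-- A cone with nonempty `F` containing both directions of a vector contains a line. -/
theorem coneOff_line_of_two {d : ℕ} {T F : Finset (Fin d → ℚ)} {u v : Fin d → ℚ} (hu : u ∈ T)
    (hv : v ∈ T) (huF : u ∈ F) (hvF : v ∈ F) (huv : u ≠ v) : ContainsLine (coneOff T F) := by
  have key : ∀ r : ℚ, v + r • (u - v) ∈ coneOff T F := by
    intro r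
    have h1 : ∑ t ∈ T, (if t = u then (1 : ℚ) else 0) = 1 := by
      rw [Finset.sum_ite_eq' T u, if_pos hu]
    have h2 : ∑ t ∈ T, (if t = u then (1 : ℚ) else 0) • t = u := by
      simp only [ite_smul, zero_smul, one_smul]
      rw [Finset.sum_ite_eq' T u, if_pos hu]
    refine ⟨_, shift_weights hv h1 h2 r, fun t ht htF => ?_⟩
    have htv : t ≠ v := by rintro rfl; exact htF hvF
    have htu : t ≠ u := by rintro rfl; exact htF huF
    rw [if_neg htv, if_neg htu]
    simp
  exact ⟨v, by simpa using key 0, u - v, sub_ne_zero.2 huv, key⟩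

theorem coneOff_line_of_not_vertex {d : ℕ} {T : Finset (Fin d → ℚ)} {v : Fin d → ℚ}
    (hv : v ∈ T) (hnv : ¬ IsVertex (convexHull ℚ (T : Set (Fin d → ℚ))) v) :
    ContainsLine (coneOff T {v}) := by
  rcases gordan_aux ((T.erase v).image (fun t => t - v)) ⊥ with ⟨l, -, hl⟩ | ⟨c, hc, ⟨z, hz, hcz⟩, h0⟩
  · exfalso
    apply hnv
    have hl' : ∀ t ∈ T, t ≠ v → l t < l v := by
      intro t ht htv
      have := hl (t - v) (Finset.mem_image.2 ⟨t, Finset.mem_erase.2 ⟨htv, ht⟩, rfl⟩)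
      rw [map_sub] at this
      linarith
    have hvP : v ∈ convexHull ℚ (T : Set (Fin d → ℚ)) := subset_convexHull ℚ _ hv
    have hmax : ∀ y ∈ convexHull ℚ (T : Set (Fin d → ℚ)), l y ≤ l v ∧ (l y = l v → y = v) := by
      intro y hy
      rw [Finset.mem_convexHull'] at hy
      obtain ⟨w, hw, h1, h2⟩ := hy
      have e1 : l v - l y = ∑ t ∈ T, w t * (l v - l t) := by
        simp only [mul_sub, Finset.sum_sub_distrib, ← Finset.sum_mul, h1, one_mul, ← h2, map_sum,
          map_smul, smul_eq_mul]
      have hnn : ∀ t ∈ T, 0 ≤ w t * (l v - l t) := by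
        intro t ht
        by_cases h : t = v
        · subst h; simp
        · exact mul_nonneg (hw t ht) (sub_nonneg.2 (hl' t ht h).le)
      refine ⟨by linarith [Finset.sum_nonneg hnn], fun heq => ?_⟩
      rw [heq, sub_self] at e1
      have hz := (Finset.sum_eq_zero_iff_of_nonneg hnn).1 e1.symm
      have hw0 : ∀ t ∈ T, t ≠ v → w t = 0 := by
        intro t ht htv
        rcases mul_eq_zero.1 (hz t ht) with h | h
        · exact h
        · linarith [hl' t ht htv]
      have hwv : w v = 1 := by
        rw [← h1]; exact (Finset.sum_eq_single_of_mem v hv hw0).symm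
      rw [← h2, Finset.sum_eq_single_of_mem v hv (fun t ht htv => by rw [hw0 t ht htv, zero_smul]),
        hwv, one_smul]
    refine ⟨l, ?_⟩
    ext y
    simp only [Set.mem_singleton_iff, Set.mem_ofPred_eq]
    constructor
    · rintro rfl
      exact ⟨hvP, fun y hy => (hmax y hy).1⟩
    · rintro ⟨hy, h⟩
      exact (hmax y hy).2 (le_antisymm (hmax y hy).1 (h v hvP))
  · obtain ⟨u, hu, rfl⟩ := Finset.mem_image.1 hz
    rw [Finset.mem_erase] at hu
    rw [Submodule.mem_bot, Finset.sum_image (by intro a _ b _ h; simpa using h)] at h0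
    have key : ∀ r : ℚ, v + r • (u - v) ∈ coneOff T {v} := by
      intro r
      set N : ℚ := |r| / c (u - v) with hN
      have hN0 : 0 ≤ N := by positivity
      have hNc : N * c (u - v) = |r| := by rw [hN]; field_simp
      let g : (Fin d → ℚ) → ℚ := fun t => N * c (t - v) + if t = u then r else 0
      have hg : ∑ t ∈ T.erase v, g t • (t - v) = r • (u - v) := by
        simp only [g, add_smul, mul_smul, Finset.sum_add_distrib, ← Finset.smul_sum, h0, ite_smul,
          zero_smul, smul_zero, zero_add]
        rw [Finset.sum_ite_eq' (T.erase v) u, if_pos (Finset.mem_erase.2 hu)]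
      refine ⟨fun t => if t = v then 1 - ∑ s ∈ T.erase v, g s else g t, ⟨?_, ?_⟩, ?_⟩
      · rw [← Finset.add_sum_erase T _ hv, if_pos rfl]
        rw [Finset.sum_congr rfl (fun t ht => if_neg (Finset.ne_of_mem_erase ht))]
        ring
      · rw [← Finset.add_sum_erase T _ hv, ← hg]
        dsimp only
        rw [if_pos rfl]
        have hcongr : ∀ t ∈ T.erase v,
            (if t = v then 1 - ∑ s ∈ T.erase v, g s else g t) • t = g t • t := fun t ht => by
          rw [if_neg (Finset.ne_of_mem_erase ht)]
        rw [Finset.sum_congr rfl hcongr]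
        simp only [smul_sub, Finset.sum_sub_distrib, sub_smul, one_smul, Finset.sum_smul]
        abel
      · intro t ht htv
        have htv' : t ≠ v := by simpa using htv
        dsimp only
        rw [if_neg htv']
        simp only [g]
        split_ifs with h
        · subst h
          rw [hNc]; linarith [neg_abs_le r]
        · rw [add_zero]
          exact mul_nonneg hN0 (hc _ (Finset.mem_image.2 ⟨t, Finset.mem_erase.2 ⟨htv', ht⟩, rfl⟩))
    exact ⟨v, by simpa using key 0, u - v, sub_ne_zero.2 hu.1, key⟩

theorem vertex_mem {d : ℕ} {T : Finset (Fin d → ℚ)} {v : Fin d → ℚ}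
    (h : IsVertex (convexHull ℚ (T : Set (Fin d → ℚ))) v) : v ∈ T := by
  obtain ⟨l, hl⟩ := h
  have hv : v ∈ ({v} : Set (Fin d → ℚ)) := rfl
  rw [hl] at hv
  have hne : T.Nonempty := by
    have : (convexHull ℚ (T : Set (Fin d → ℚ))).Nonempty := ⟨v, hv.1⟩
    rw [convexHull_nonempty_iff] at this
    exact_mod_cast this
  obtain ⟨t, ht, hmax⟩ := T.exists_max_image l hne
  have : t ∈ ({v} : Set (Fin d → ℚ)) := by
    rw [hl]
    refine ⟨subset_convexHull ℚ _ ht, fun y hy => ?_⟩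
    rw [Finset.mem_convexHull'] at hy
    obtain ⟨w, hw, h1, h2⟩ := hy
    rw [← h2, map_sum]
    calc ∑ s ∈ T, l (w s • s) ≤ ∑ s ∈ T, w s * l t := by
          refine Finset.sum_le_sum fun s hs => ?_
          rw [map_smul, smul_eq_mul]
          exact mul_le_mul_of_nonneg_left (hmax s hs) (hw s hs)
      _ = l t := by rw [← Finset.sum_mul, h1, one_mul]
  rw [Set.mem_singleton_iff] at this
  exact this ▸ ht

/-- **Brion's theorem, indicator-function version**: `1_P` minus the sum of the
indicator functions of the tangent cones at the vertices is a finite integer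
linear combination of indicator functions of convex cones containing affine lines. -/
theorem brion_indicator {d : ℕ} (hd : 1 ≤ d) (P : Set (Fin d → ℚ))
    (hP : IsPolytope P) (hfull : affineSpan ℚ P = ⊤) :
    ∃ (m : ℕ) (K : Fin m → Set (Fin d → ℚ)) (c : Fin m → ℤ),
      (∀ j, (∃ a, IsConvexConeAt a (K j)) ∧ ContainsLine (K j)) ∧
      ∀ x : Fin d → ℚ,
        indicator P x - (∑ᶠ v ∈ {v : Fin d → ℚ | IsVertex P v},
            indicator (tangentCone P {v}) x) =
          ∑ j, c j * indicator (K j) x := by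
  obtain ⟨T, rfl⟩ := hP
  set P := convexHull ℚ (T : Set (Fin d → ℚ)) with hPdef
  let V : Finset (Fin d → ℚ) := T.filter (fun v => IsVertex P v)
  have hVset : {v : Fin d → ℚ | IsVertex P v} = (V : Set (Fin d → ℚ)) := by
    ext v
    simp only [V, Set.mem_ofPred_eq, Finset.coe_filter]
    exact ⟨fun h => ⟨vertex_mem h, h⟩, fun h => h.2⟩
  let I : Finset (Finset (Fin d → ℚ)) := insert ∅ (V.image (fun v => {v}))
  have hIsub : I ⊆ T.powerset := by
    intro F hF
    rcases Finset.mem_insert.1 hF with rfl | hF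
    · simp
    · obtain ⟨v, hv, rfl⟩ := Finset.mem_image.1 hF
      simpa using (Finset.mem_filter.1 hv).1
  let J := T.powerset \ I
  have hJ : ∀ F ∈ J, (∃ a, IsConvexConeAt a (coneOff T F)) ∧ ContainsLine (coneOff T F) := by
    intro F hF
    obtain ⟨hFT, hFI⟩ := Finset.mem_sdiff.1 hF
    rw [Finset.mem_powerset] at hFT
    have hne : F.Nonempty := by
      rw [Finset.nonempty_iff_ne_empty]
      rintro rfl
      exact hFI (Finset.mem_insert_self _ _)
    obtain ⟨v, hv⟩ := hne
    refine ⟨⟨v, coneOff_cone (hFT hv) hv⟩, ?_⟩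
    by_cases hs : F = {v}
    · subst hs
      refine coneOff_line_of_not_vertex (hFT hv) (fun hvert => hFI ?_)
      exact Finset.mem_insert_of_mem (Finset.mem_image.2
        ⟨v, Finset.mem_filter.2 ⟨hFT hv, hvert⟩, rfl⟩)
    · obtain ⟨u, hu, huv⟩ : ∃ u ∈ F, u ≠ v := by
        by_contra hcon
        push Not at hcon
        exact hs (Finset.eq_singleton_iff_unique_mem.2 ⟨hv, hcon⟩)
      exact coneOff_line_of_two (hFT hu) (hFT hv) hu hv huv
  let e := J.equivFin
  refine ⟨J.card, fun j => coneOff T (e.symm j).1, fun j => -(-1) ^ (e.symm j).1.card,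
    fun j => hJ _ (e.symm j).2, fun x => ?_⟩
  rw [hVset, finsum_mem_coe_finset]
  rw [Equiv.sum_comp e.symm (fun F : J => -(-1 : ℤ) ^ F.1.card * indicator (coneOff T F.1) x)]
  rw [Finset.sum_coe_sort J (fun F => -(-1 : ℤ) ^ F.card * indicator (coneOff T F) x)]
  have hs := coneOff_sum T x
  rw [← Finset.sum_sdiff hIsub] at hs
  have hI : ∑ F ∈ I, (-1 : ℤ) ^ F.card * indicator (coneOff T F) x =
      indicator P x - ∑ v ∈ V, indicator (tangentCone P {v}) x := by
    rw [Finset.sum_insert (by simp), Finset.sum_image (by intro a _ b _ h; simpa using h),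
      coneOff_empty]
    rw [Finset.sum_congr rfl (fun v hv => by
      rw [coneOff_singleton (Finset.mem_filter.1 hv).1, Finset.card_singleton, pow_one,
        neg_one_mul])]
    rw [Finset.sum_neg_distrib]
    simp [hPdef, sub_eq_add_neg]
  rw [hI] at hs
  simp only [neg_mul, Finset.sum_neg_distrib]
  linarith
end
end

section
/- Polar decomposition of a simple polytope (Lawrence–Varchenko): Let P ⊆ ℚ^d be a full-dimensional simple polytope and ξ ∈ (ℚ^d)^* a generic linear functional. Then 1_P = Σ_{v vertex of P} (−1)^{ind_ξ(v)} · 1_{T^ξ_v P}, as functions ℚ^d → ℤ. -/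
noncomputable section
open Classical

open scoped BigOperators

/-- The simplicial cone `v + ℚ_{≥0} t_1 + … + ℚ_{≥0} t_d`. -/
def simpleCone {d : ℕ} (v : Fin d → ℚ) (t : Fin d → Fin d → ℚ) : Set (Fin d → ℚ) :=
  {x | ∃ lam : Fin d → ℚ, (∀ i, 0 ≤ lam i) ∧ x = v + ∑ i, lam i • t i}

/-- `P` is simple, with edge directions `t v` at each vertex `v`. -/
def IsSimpleWith {d : ℕ} (P : Set (Fin d → ℚ))
    (t : (Fin d → ℚ) → Fin d → Fin d → ℚ) : Prop :=
  ∀ v, IsVertex P v →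
    LinearIndependent ℚ (t v) ∧ tangentCone P {v} = simpleCone v (t v)

/-- The polarized tangent cone
`v + Σ_{ξ(t_i)>0} ℚ_{≥0} t_i + Σ_{ξ(t_i)<0} ℚ_{<0} t_i`. -/
def polarizedCone {d : ℕ} (v : Fin d → ℚ) (t : Fin d → Fin d → ℚ)
    (ξ : Module.Dual ℚ (Fin d → ℚ)) : Set (Fin d → ℚ) :=
  {x | ∃ lam : Fin d → ℚ, x = v + ∑ i, lam i • t i ∧
    ∀ i, (0 < ξ (t i) → 0 ≤ lam i) ∧ (ξ (t i) < 0 → lam i < 0)}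

/-- The index of a vertex: the number of `ξ`-negative edge directions. -/
def indAt {d : ℕ} (ξ : Module.Dual ℚ (Fin d → ℚ)) (t : Fin d → Fin d → ℚ) : ℕ :=
  (Finset.univ.filter fun i => ξ (t i) < 0).card

lemma pds_farkas {ι V : Type*} [AddCommGroup V] [Module ℚ V] (s : Finset ι) :
    ∀ (a : ι → V) (b : V),
    (∃ c : ι → ℚ, (∀ i ∈ s, 0 ≤ c i) ∧ ∑ i ∈ s, c i • a i = b) ∨
    ∃ φ : Module.Dual ℚ V, (∀ i ∈ s, 0 ≤ φ (a i)) ∧ φ b < 0 := by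
  induction s using Finset.induction_on with
  | empty =>
    intro a b
    by_cases hb : b = 0
    · left; exact ⟨0, by simp, by simp [hb]⟩
    · right
      obtain ⟨φ, hφ⟩ := Module.exists_dual_forall_apply_ne_zero (K := ℚ) (fun _ : Unit => b)
        (fun _ => hb)
      rcases lt_or_gt_of_ne (hφ ()) with h | h
      · exact ⟨φ, by simp, h⟩
      · exact ⟨-φ, by simp, by simpa using h⟩
  | insert i₀ s hi₀ ih =>
    intro a b
    rcases ih a b with ⟨c, hc, hcb⟩ | ⟨φ, hφ, hφb⟩
    · left
      refine ⟨fun i => if i = i₀ then 0 else c i, ?_, ?_⟩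
      · intro i hi
        dsimp only
        split_ifs with h
        · exact le_rfl
        · exact hc i ((Finset.mem_insert.1 hi).resolve_left h)
      · rw [Finset.sum_insert hi₀, ← hcb]
        simp only [if_true, zero_smul, zero_add]
        refine Finset.sum_congr rfl fun i hi => ?_
        rw [if_neg (by rintro rfl; exact hi₀ hi)]
    · by_cases h0 : 0 ≤ φ (a i₀)
      · right
        refine ⟨φ, fun i hi => ?_, hφb⟩
        rcases Finset.mem_insert.1 hi with rfl | hi
        · exact h0
        · exact hφ i hi
      push Not at h0
      rcases ih (fun i => a i - (φ (a i) / φ (a i₀)) • a i₀) (b - (φ b / φ (a i₀)) • a i₀) with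
        ⟨c, hc, hcb⟩ | ⟨ψ, hψ, hψb⟩
      · left
        refine ⟨fun i => if i = i₀ then φ b / φ (a i₀) - ∑ i ∈ s, c i * (φ (a i) / φ (a i₀))
          else c i, ?_, ?_⟩
        · intro i hi
          dsimp only
          split_ifs with h
          · have h1 : 0 ≤ φ b / φ (a i₀) := div_nonneg_of_nonpos hφb.le h0.le
            have h2 : ∑ i ∈ s, c i * (φ (a i) / φ (a i₀)) ≤ 0 :=
              Finset.sum_nonpos fun i hi => mul_nonpos_of_nonneg_of_nonpos (hc i hi)
                (div_nonpos_of_nonneg_of_nonpos (hφ i hi) h0.le)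
            linarith
          · exact hc i ((Finset.mem_insert.1 hi).resolve_left h)
        · rw [Finset.sum_insert hi₀]
          have h3 : ∑ i ∈ s, (if i = i₀ then φ b / φ (a i₀) -
              ∑ i ∈ s, c i * (φ (a i) / φ (a i₀)) else c i) • a i = ∑ i ∈ s, c i • a i := by
            refine Finset.sum_congr rfl fun i hi => ?_
            rw [if_neg (by rintro rfl; exact hi₀ hi)]
          rw [h3]
          beta_reduce
          rw [if_pos rfl]
          simp only [smul_sub, Finset.sum_sub_distrib, smul_smul, ← Finset.sum_smul] at hcb
          rw [sub_smul]
          rw [sub_eq_sub_iff_add_eq_add] at hcb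
          rw [sub_add_eq_add_sub, sub_eq_iff_eq_add, add_comm, hcb]
      · right
        refine ⟨ψ - (ψ (a i₀) / φ (a i₀)) • φ, ?_, ?_⟩
        · intro i hi
          rcases Finset.mem_insert.1 hi with rfl | hi
          · have := h0.ne
            simp [this]
          · have := hψ i hi
            simp only [map_sub, map_smul, smul_eq_mul, LinearMap.sub_apply,
              LinearMap.smul_apply] at this ⊢
            have h4 : ψ (a i₀) / φ (a i₀) * φ (a i) = φ (a i) / φ (a i₀) * ψ (a i₀) := by ring
            linarith
        · simp only [map_sub, map_smul, smul_eq_mul, LinearMap.sub_apply,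
              LinearMap.smul_apply] at hψb ⊢
          have h4 : ψ (a i₀) / φ (a i₀) * φ b = φ b / φ (a i₀) * ψ (a i₀) := by ring
          linarith

lemma pds_sep {d : ℕ} (T : Finset (Fin d → ℚ)) (x : Fin d → ℚ)
    (hx : x ∉ convexHull ℚ (T : Set (Fin d → ℚ))) :
    ∃ η : Module.Dual ℚ (Fin d → ℚ), ∀ a ∈ T, η x < η a := by
  rcases pds_farkas T (fun y : Fin d → ℚ => (y, (1 : ℚ))) (x, 1) with ⟨c, hc, hcb⟩ | ⟨φ, hφ, hφb⟩
  · exfalso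
    apply hx
    have h1 : ∑ i ∈ T, c i = 1 := by
      have := congrArg Prod.snd hcb
      simpa [Prod.snd_sum] using this
    have h2 : ∑ i ∈ T, c i • i = x := by
      have := congrArg Prod.fst hcb
      simpa [Prod.fst_sum] using this
    rw [← h2]
    exact (convex_convexHull ℚ _).sum_mem hc h1 fun i hi => subset_convexHull ℚ _ hi
  · refine ⟨φ.comp (LinearMap.inl ℚ _ _), fun a ha => ?_⟩
    have h1 := hφ a ha
    have h2 : ∀ y : Fin d → ℚ, φ (y, 1) = φ (y, 0) + φ (0, 1) := by
      intro y; rw [← map_add]; simp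
    rw [h2] at h1 hφb
    simp only [LinearMap.comp_apply, LinearMap.inl_apply]
    linarith

/-- small perturbations preserve finitely many strict inequalities -/
lemma pds_eps {ι : Type*} (s : Finset ι) (f g : ι → ℚ) :
    ∃ ε : ℚ, 0 < ε ∧ ∀ i ∈ s, f i ≠ 0 → (0 < f i → 0 < f i + ε * g i) ∧ f i + ε * g i ≠ 0 := by
  have key : ∃ ε : ℚ, 0 < ε ∧ ∀ i ∈ s, f i ≠ 0 → ε * |g i| < |f i| := by
    induction s using Finset.induction_on with
    | empty => exact ⟨1, one_pos, by simp⟩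
    | insert i₀ s hi₀ ih =>
      obtain ⟨ε, hε, h⟩ := ih
      by_cases hf : f i₀ = 0
      · refine ⟨ε, hε, fun i hi hfi => ?_⟩
        rcases Finset.mem_insert.1 hi with rfl | hi
        · exact absurd hf hfi
        · exact h i hi hfi
      · have hp : 0 < |f i₀| := abs_pos.2 hf
        have hq : 0 < |g i₀| + 1 := by positivity
        refine ⟨min ε (|f i₀| / (|g i₀| + 1)), lt_min hε (div_pos hp hq), fun i hi hfi => ?_⟩
        rcases Finset.mem_insert.1 hi with rfl | hi
        · have h1 := min_le_right ε (|f i| / (|g i| + 1))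
          calc _ ≤ |f i| / (|g i| + 1) * |g i| := by gcongr
            _ < |f i| / (|g i| + 1) * (|g i| + 1) := by
              apply mul_lt_mul_of_pos_left (by linarith) (div_pos hp hq)
            _ = |f i| := by field_simp
        · refine lt_of_le_of_lt ?_ (h i hi hfi)
          gcongr
          exact min_le_left _ _
  obtain ⟨ε, hε, h⟩ := key
  refine ⟨ε, hε, fun i hi hfi => ?_⟩
  have h1 := h i hi hfi
  have h2 : |ε * g i| < |f i| := by rwa [abs_mul, abs_of_pos hε]
  constructor
  · intro hp
    rw [abs_of_pos hp] at h2
    have := neg_abs_le (ε * g i)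
    linarith
  · intro h0
    have : f i = -(ε * g i) := by linarith
    rw [this, abs_neg] at h2
    exact lt_irrefl _ h2

lemma pds_hull_le {d : ℕ} {T : Finset (Fin d → ℚ)} (ℓ : Module.Dual ℚ (Fin d → ℚ)) (c : ℚ)
    (h : ∀ a ∈ T, ℓ a ≤ c) : ∀ y ∈ convexHull ℚ (T : Set (Fin d → ℚ)), ℓ y ≤ c := by
  have : convexHull ℚ (T : Set (Fin d → ℚ)) ⊆ {y | ℓ y ≤ c} :=
    convexHull_min (fun a ha => h a ha) (convex_halfSpace_le ℓ.isLinear c)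
  exact this

lemma pds_hull_lt {d : ℕ} {T : Finset (Fin d → ℚ)} (ℓ : Module.Dual ℚ (Fin d → ℚ)) (c : ℚ)
    (h : ∀ a ∈ T, ℓ a < c) : ∀ y ∈ convexHull ℚ (T : Set (Fin d → ℚ)), ℓ y < c := by
  have : convexHull ℚ (T : Set (Fin d → ℚ)) ⊆ {y | ℓ y < c} :=
    convexHull_min (fun a ha => h a ha) (convex_halfSpace_lt ℓ.isLinear c)
  exact this

lemma pds_vertex_mem {d : ℕ} {T : Finset (Fin d → ℚ)} {v : Fin d → ℚ}
    (hv : IsVertex (convexHull ℚ (T : Set (Fin d → ℚ))) v) : v ∈ T := by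
  obtain ⟨ℓ, hℓ⟩ := hv
  have h1 : v ∈ convexHull ℚ (T : Set (Fin d → ℚ)) ∧ ∀ y ∈ convexHull ℚ (T : Set (Fin d → ℚ)),
      ℓ y ≤ ℓ v := by
    have : v ∈ ({v} : Set (Fin d → ℚ)) := rfl
    rw [hℓ] at this; exact this
  by_contra hvT
  have h2 : ∀ a ∈ T, ℓ a < ℓ v := by
    intro a ha
    have haP := subset_convexHull ℚ (T : Set (Fin d → ℚ)) ha
    refine lt_of_le_of_ne (h1.2 a haP) fun he => ?_
    have : a ∈ ({v} : Set (Fin d → ℚ)) := by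
      rw [hℓ]; exact ⟨haP, fun y hy => he ▸ h1.2 y hy⟩
    rw [Set.mem_singleton_iff] at this
    exact hvT (this ▸ ha)
  exact lt_irrefl _ (pds_hull_lt ℓ _ h2 v h1.1)

lemma pds_refine {d : ℕ} (T : Finset (Fin d → ℚ)) (ℓ ζ : Module.Dual ℚ (Fin d → ℚ)) :
    ∃ ℓ' : Module.Dual ℚ (Fin d → ℚ), (∀ a ∈ T, ∀ b ∈ T, ℓ a < ℓ b → ℓ' a < ℓ' b) ∧
      (∀ a b, ℓ a = ℓ b → ζ a < ζ b → ℓ' a < ℓ' b) := by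
  obtain ⟨ε, hε, h⟩ := pds_eps (T ×ˢ T) (fun p => ℓ p.2 - ℓ p.1) (fun p => ζ p.2 - ζ p.1)
  refine ⟨ℓ + ε • ζ, ?_, ?_⟩
  · intro a ha b hb hab
    have := (h (a, b) (Finset.mk_mem_product ha hb) (sub_pos.2 hab).ne').1 (sub_pos.2 hab)
    simp only [LinearMap.add_apply, LinearMap.smul_apply, smul_eq_mul]
    dsimp only at this
    linarith
  · intro a b hab hz
    simp only [LinearMap.add_apply, LinearMap.smul_apply, smul_eq_mul, hab]
    have := mul_lt_mul_of_pos_left hz hε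
    linarith

lemma pds_injective {d : ℕ} (T : Finset (Fin d → ℚ)) :
    ∃ ρ : Module.Dual ℚ (Fin d → ℚ), ∀ a ∈ T, ∀ b ∈ T, a ≠ b → ρ a ≠ ρ b := by
  obtain ⟨ρ, hρ⟩ := Module.exists_dual_forall_apply_ne_zero (K := ℚ)
    (fun p : {p : T × T // p.1.1 ≠ p.2.1} => p.1.1.1 - p.1.2.1) (fun p => sub_ne_zero.2 p.2)
  refine ⟨ρ, fun a ha b hb hab he => ?_⟩
  have := hρ ⟨(⟨a, ha⟩, ⟨b, hb⟩), hab⟩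
  simp [he] at this

/-- Every nonempty face contains a vertex of the polytope maximizing a given functional. -/
lemma pds_exists_vertex {d : ℕ} (T : Finset (Fin d → ℚ)) (hT : T.Nonempty)
    (ℓ ζ : Module.Dual ℚ (Fin d → ℚ)) :
    ∃ w, IsVertex (convexHull ℚ (T : Set (Fin d → ℚ))) w ∧
      w ∈ convexHull ℚ (T : Set (Fin d → ℚ)) ∧
      (∀ y ∈ convexHull ℚ (T : Set (Fin d → ℚ)), ℓ y ≤ ℓ w) ∧
      (∀ y ∈ convexHull ℚ (T : Set (Fin d → ℚ)), ℓ y = ℓ w → ζ y ≤ ζ w) := by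
  obtain ⟨ρ, hρ⟩ := pds_injective T
  obtain ⟨ℓ₂, h21, h22⟩ := pds_refine T ℓ ζ
  obtain ⟨ℓ₃, h31, h32⟩ := pds_refine T ℓ₂ ρ
  obtain ⟨w, hw, hmax⟩ := T.exists_max_image ℓ₃ hT
  have hm2 : ∀ a ∈ T, ℓ₂ a ≤ ℓ₂ w := fun a ha => by
    by_contra hlt; push Not at hlt
    exact absurd (hmax a ha) (not_le.2 (h31 w hw a ha hlt))
  have hm1 : ∀ a ∈ T, ℓ a ≤ ℓ w := fun a ha => by
    by_contra hlt; push Not at hlt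
    exact absurd (hm2 a ha) (not_le.2 (h21 w hw a ha hlt))
  have hinj : ∀ a ∈ T, a ≠ w → ℓ₃ a < ℓ₃ w := fun a ha hne => by
    refine lt_of_le_of_ne (hmax a ha) fun he => ?_
    rcases lt_trichotomy (ℓ₂ a) (ℓ₂ w) with h | h | h
    · exact (h31 a ha w hw h).ne he
    · rcases lt_or_gt_of_ne (hρ a ha w hw hne) with h' | h'
      · exact (h32 a w h h').ne he
      · exact (h32 w a h.symm h').ne he.symm
    · exact (h31 w hw a ha h).ne he.symm
  have hwP := subset_convexHull ℚ (T : Set (Fin d → ℚ)) hw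
  refine ⟨w, ⟨ℓ₃, ?_⟩, hwP, pds_hull_le ℓ _ hm1, ?_⟩
  · have hconv : Convex ℚ {y : Fin d → ℚ | ℓ₃ y < ℓ₃ w ∨ y = w} := by
      intro x hx y hy a b ha hb hab
      rcases ha.eq_or_lt with rfl | ha
      · have : b = 1 := by linarith
        subst this; simpa using hy
      rcases hb.eq_or_lt with rfl | hb
      · have : a = 1 := by linarith
        subst this; simpa using hx
      have hb' : b = 1 - a := by linarith
      rcases hx with hx | rfl
      · left
        have hy' : ℓ₃ y ≤ ℓ₃ w := by
          rcases hy with hy | rfl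
          · exact hy.le
          · exact le_rfl
        simp only [map_add, map_smul, smul_eq_mul]
        subst hb'
        nlinarith
      · rcases hy with hy | rfl
        · left
          simp only [map_add, map_smul, smul_eq_mul]
          subst hb'
          nlinarith
        · right
          rw [← add_smul, hab, one_smul]
    have hsub : convexHull ℚ (T : Set (Fin d → ℚ)) ⊆ {y : Fin d → ℚ | ℓ₃ y < ℓ₃ w ∨ y = w} := by
      refine convexHull_min (fun a ha => ?_) hconv
      by_cases h : a = w
      · exact Or.inr h
      · exact Or.inl (hinj a ha h)
    ext y
    simp only [Set.mem_singleton_iff, Set.mem_ofPred_eq]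
    constructor
    · rintro rfl
      exact ⟨hwP, pds_hull_le ℓ₃ _ hmax⟩
    · rintro ⟨hy, hy2⟩
      rcases hsub hy with h | h
      · exact absurd (hy2 w hwP) (not_le.2 h)
      · exact h
  · intro y hy he
    by_contra hlt; push Not at hlt
    exact absurd (pds_hull_le ℓ₂ _ hm2 y hy) (not_le.2 (h22 w y he.symm hlt))

structure PdsGood {d : ℕ} (P : Set (Fin d → ℚ)) (v : Fin d → ℚ)
    (b : Module.Basis (Fin d) ℚ (Fin d → ℚ)) : Prop where
  mem : v ∈ P
  nonneg : ∀ y ∈ P, ∀ i, 0 ≤ b.repr (y - v) i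
  edge : ∀ i, ∃ δ : ℚ, 0 < δ ∧ v + δ • b i ∈ P

def pdsFace {d : ℕ} (P : Set (Fin d → ℚ)) (v : Fin d → ℚ)
    (b : Module.Basis (Fin d) ℚ (Fin d → ℚ)) (J : Finset (Fin d)) : Set (Fin d → ℚ) :=
  {y ∈ P | ∀ i, i ∉ J → b.repr (y - v) i = 0}

/-- the tangent cone of a face, described by the normal cone -/
def pdsTan {d : ℕ} (P F : Set (Fin d → ℚ)) (x : Fin d → ℚ) : Prop :=
  ∀ ℓ : Module.Dual ℚ (Fin d → ℚ), (∀ f ∈ F, ∀ y ∈ P, ℓ y ≤ ℓ f) → ∀ f ∈ F, ℓ x ≤ ℓ f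

section
variable {d : ℕ} {P : Set (Fin d → ℚ)} {v : Fin d → ℚ}
  {b : Module.Basis (Fin d) ℚ (Fin d → ℚ)}

lemma pds_expand (b : Module.Basis (Fin d) ℚ (Fin d → ℚ)) (v x : Fin d → ℚ)
    (ℓ : Module.Dual ℚ (Fin d → ℚ)) :
    ℓ x = ℓ v + ∑ i, b.repr (x - v) i * ℓ (b i) := by
  have h := congrArg ℓ (b.sum_repr (x - v))
  rw [map_sum, map_sub ℓ] at h
  simp only [map_smul, smul_eq_mul] at h
  linarith

lemma PdsGood.base_mem (h : PdsGood P v b) (J : Finset (Fin d)) : v ∈ pdsFace P v b J :=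
  ⟨h.mem, by simp⟩

lemma PdsGood.edge_repr (v : Fin d → ℚ) (b : Module.Basis (Fin d) ℚ (Fin d → ℚ)) (δ : ℚ)
    (i j : Fin d) : b.repr (v + δ • b i - v) j = if i = j then δ else 0 := by
  simp [Finsupp.single_apply]

lemma PdsGood.edge_mem (h : PdsGood P v b) (J : Finset (Fin d)) {j : Fin d} (hj : j ∈ J) :
    ∃ δ : ℚ, 0 < δ ∧ v + δ • b j ∈ pdsFace P v b J := by
  obtain ⟨δ, hδ, hm⟩ := h.edge j
  refine ⟨δ, hδ, hm, fun i hi => ?_⟩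
  rw [PdsGood.edge_repr, if_neg]
  rintro rfl
  exact hi hj

lemma PdsGood.isFace (h : PdsGood P v b) (J : Finset (Fin d)) : IsFace P (pdsFace P v b J) := by
  refine ⟨-∑ i ∈ Jᶜ, b.coord i, ?_⟩
  have hval : ∀ y, (-∑ i ∈ Jᶜ, b.coord i) y =
      (-∑ i ∈ Jᶜ, b.coord i) v - ∑ i ∈ Jᶜ, b.repr (y - v) i := by
    intro y
    simp only [LinearMap.neg_apply, LinearMap.sum_apply, Module.Basis.coord_apply, map_sub,
      Finsupp.sub_apply, Finset.sum_sub_distrib]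
    ring
  ext y
  constructor
  · rintro ⟨hy, h0⟩
    refine ⟨hy, fun z hz => ?_⟩
    rw [hval y, hval z]
    have h1 : ∑ i ∈ Jᶜ, b.repr (y - v) i = 0 :=
      Finset.sum_eq_zero fun i hi => h0 i (Finset.mem_compl.1 hi)
    have h2 : 0 ≤ ∑ i ∈ Jᶜ, b.repr (z - v) i := Finset.sum_nonneg fun i _ => h.nonneg z hz i
    linarith
  · rintro ⟨hy, hm⟩
    refine ⟨hy, fun i hi => ?_⟩
    have h1 := hm v h.mem
    rw [hval y] at h1
    have h2 : ∑ i ∈ Jᶜ, b.repr (y - v) i = 0 :=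
      le_antisymm (by linarith) (Finset.sum_nonneg fun i _ => h.nonneg y hy i)
    exact (Finset.sum_eq_zero_iff_of_nonneg fun i _ => h.nonneg y hy i).1 h2 i
      (Finset.mem_compl.2 hi)

lemma PdsGood.face_eq (h : PdsGood P v b) {F : Set (Fin d → ℚ)} (hF : IsFace P F) (hv : v ∈ F) :
    ∃ J, F = pdsFace P v b J := by
  obtain ⟨ℓ, rfl⟩ := hF
  have hneg : ∀ i, ℓ (b i) ≤ 0 := by
    intro i
    obtain ⟨δ, hδ, hm⟩ := h.edge i
    have := hv.2 _ hm
    rw [map_add, map_smul, smul_eq_mul] at this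
    by_contra hc
    push Not at hc
    have := mul_pos hδ hc
    linarith
  refine ⟨Finset.univ.filter fun i => ℓ (b i) = 0, ?_⟩
  ext y
  constructor
  · rintro ⟨hy, hm⟩
    refine ⟨hy, fun i hi => ?_⟩
    have hi' : ℓ (b i) ≠ 0 := by simpa using hi
    have h1 := hm v h.mem
    rw [pds_expand b v y ℓ] at h1
    have hnp : ∀ i, b.repr (y - v) i * ℓ (b i) ≤ 0 := fun i =>
      mul_nonpos_of_nonneg_of_nonpos (h.nonneg y hy i) (hneg i)
    have h2 : ∑ i, b.repr (y - v) i * ℓ (b i) = 0 :=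
      le_antisymm (Finset.sum_nonpos fun i _ => hnp i) (by linarith)
    have h3 := (Finset.sum_eq_zero_iff_of_nonpos fun i _ => hnp i).1 h2 i (Finset.mem_univ i)
    exact (mul_eq_zero.1 h3).resolve_right hi'
  · rintro ⟨hy, h0⟩
    refine ⟨hy, fun z hz => ?_⟩
    have : ℓ y = ℓ v := by
      rw [pds_expand b v y ℓ, Finset.sum_eq_zero, add_zero]
      intro i _
      by_cases hi : ℓ (b i) = 0
      · rw [hi, mul_zero]
      · rw [h0 i (by simpa using hi), zero_mul]
    rw [this]
    exact hv.2 z hz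

lemma PdsGood.tan_iff (h : PdsGood P v b) (J : Finset (Fin d)) (x : Fin d → ℚ) :
    pdsTan P (pdsFace P v b J) x ↔ ∀ i, i ∉ J → 0 ≤ b.repr (x - v) i := by
  constructor
  · intro hx i hi
    have := hx (-b.coord i) ?_ v (h.base_mem J)
    · simp only [LinearMap.neg_apply, Module.Basis.coord_apply, map_sub, Finsupp.sub_apply] at this ⊢
      linarith
    · intro f hf y hy
      have h1 := hf.2 i hi
      have h2 := h.nonneg y hy i
      simp only [LinearMap.neg_apply, Module.Basis.coord_apply, map_sub, Finsupp.sub_apply]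
        at h1 h2 ⊢
      linarith
  · intro hx ℓ hℓ f hf
    have hneg : ∀ i, ℓ (b i) ≤ 0 := by
      intro i
      obtain ⟨δ, hδ, hm⟩ := h.edge i
      have := hℓ v (h.base_mem J) _ hm
      rw [map_add, map_smul, smul_eq_mul] at this
      by_contra hc
      push Not at hc
      have := mul_pos hδ hc
      linarith
    have hJ : ∀ i ∈ J, ℓ (b i) = 0 := by
      intro i hi
      obtain ⟨δ, hδ, hm⟩ := h.edge_mem J hi
      have := hℓ _ hm v h.mem
      rw [map_add, map_smul, smul_eq_mul] at this
      have h3 : 0 ≤ δ * ℓ (b i) := by linarith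
      exact le_antisymm (hneg i) (nonneg_of_mul_nonneg_right h3 hδ)
    have hv : ℓ v ≤ ℓ f := hℓ f hf v h.mem
    refine le_trans ?_ hv
    rw [pds_expand b v x ℓ]
    have : ∑ i, b.repr (x - v) i * ℓ (b i) ≤ 0 := by
      refine Finset.sum_nonpos fun i _ => ?_
      by_cases hi : i ∈ J
      · rw [hJ i hi, mul_zero]
      · exact mul_nonpos_of_nonneg_of_nonpos (hx i hi) (hneg i)
    linarith

lemma PdsGood.vectorSpan_eq (h : PdsGood P v b) (J : Finset (Fin d)) :
    vectorSpan ℚ (pdsFace P v b J) = Submodule.span ℚ (Set.range fun j : J => b j) := by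
  apply le_antisymm
  · rw [vectorSpan_eq_span_vsub_set_right ℚ (h.base_mem J), Submodule.span_le]
    rintro _ ⟨y, hy, rfl⟩
    simp only [vsub_eq_sub, SetLike.mem_coe]
    rw [← b.sum_repr (y - v)]
    refine Submodule.sum_mem _ fun i _ => ?_
    by_cases hi : i ∈ J
    · exact Submodule.smul_mem _ _ (Submodule.subset_span ⟨⟨i, hi⟩, rfl⟩)
    · rw [hy.2 i hi, zero_smul]; exact Submodule.zero_mem _
  · rw [Submodule.span_le]
    rintro _ ⟨⟨j, hj⟩, rfl⟩
    obtain ⟨δ, hδ, hm⟩ := h.edge_mem J hj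
    have := vsub_mem_vectorSpan ℚ hm (h.base_mem J)
    rw [vsub_eq_sub, add_sub_cancel_left] at this
    exact (Submodule.smul_mem_iff _ hδ.ne').1 this

lemma PdsGood.finrank_eq (h : PdsGood P v b) (J : Finset (Fin d)) :
    Module.finrank ℚ (vectorSpan ℚ (pdsFace P v b J)) = J.card := by
  rw [h.vectorSpan_eq J, finrank_span_eq_card]
  · simp
  · exact b.linearIndependent.comp _ Subtype.val_injective

lemma PdsGood.face_subset (h : PdsGood P v b) {J K : Finset (Fin d)}
    (hJK : pdsFace P v b J = pdsFace P v b K) : J ⊆ K := by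
  intro j hj
  obtain ⟨δ, hδ, hm⟩ := h.edge_mem J hj
  rw [hJK] at hm
  by_contra hk
  have := hm.2 j hk
  rw [PdsGood.edge_repr, if_pos rfl] at this
  exact hδ.ne' this

lemma PdsGood.unique_max (h : PdsGood P v b) {J : Finset (Fin d)}
    (ξ : Module.Dual ℚ (Fin d → ℚ)) (hJ : ∀ j ∈ J, ξ (b j) < 0) {y : Fin d → ℚ}
    (hy : y ∈ pdsFace P v b J) (hle : ξ v ≤ ξ y) : y = v := by
  rw [pds_expand b v y ξ] at hle
  have hnp : ∀ i, b.repr (y - v) i * ξ (b i) ≤ 0 := fun i => by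
    by_cases hi : i ∈ J
    · exact mul_nonpos_of_nonneg_of_nonpos (h.nonneg y hy.1 i) (hJ i hi).le
    · rw [hy.2 i hi, zero_mul]
  have h2 : ∑ i, b.repr (y - v) i * ξ (b i) = 0 :=
      le_antisymm (Finset.sum_nonpos fun i _ => hnp i) (by linarith)
  have h3 : b.repr (y - v) = 0 := by
    ext i
    by_cases hi : i ∈ J
    · have h3 := (Finset.sum_eq_zero_iff_of_nonpos fun i _ => hnp i).1 h2 i (Finset.mem_univ i)
      exact (mul_eq_zero.1 h3).resolve_right (hJ i hi).ne
    · exact hy.2 i hi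
  have h4 : y - v = 0 := b.repr.map_eq_zero_iff.1 h3
  exact sub_eq_zero.1 h4

end

lemma pds_ite (p q : Prop) [Decidable p] [Decidable q] [Decidable (p ∧ q)] :
    (if p then (1 : ℤ) else 0) * (if q then 1 else 0) =
    if p ∧ q then 1 else 0 := by
  by_cases hp : p <;> by_cases hq : q <;> simp [hp, hq]

lemma pds_sign {d : ℕ} (N : Finset (Fin d)) (p : Fin d → Prop) [DecidablePred p] :
    (-1 : ℤ) ^ N.card * (if (∀ i, (i ∉ N → p i) ∧ (i ∈ N → ¬ p i)) then 1 else 0) =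
    ∑ J ∈ N.powerset, (-1 : ℤ) ^ J.card * (if (∀ i, i ∉ J → p i) then 1 else 0) := by
  have h1 : ∀ J ∈ N.powerset, (-1 : ℤ) ^ J.card * (if (∀ i, i ∉ J → p i) then 1 else 0) =
      ((∏ i ∈ J, (-1 : ℤ)) * ∏ i ∈ N \ J, (if p i then (1 : ℤ) else 0)) *
        ∏ i ∈ Nᶜ, (if p i then (1 : ℤ) else 0) := by
    intro J hJ
    rw [Finset.mem_powerset] at hJ
    rw [Finset.prod_const, Finset.prod_boole, Finset.prod_boole, mul_assoc, pds_ite]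
    congr 1
    apply if_congr _ rfl rfl
    constructor
    · intro h
      exact ⟨fun i hi => h i (Finset.mem_sdiff.1 hi).2,
        fun i hi => h i fun hc => (Finset.mem_compl.1 hi) (hJ hc)⟩
    · rintro ⟨h1, h2⟩ i hi
      by_cases hN : i ∈ N
      · exact h1 i (Finset.mem_sdiff.2 ⟨hN, hi⟩)
      · exact h2 i (Finset.mem_compl.2 hN)
  rw [Finset.sum_congr rfl h1, ← Finset.sum_mul, ← Finset.prod_add]
  have h2 : ∀ i ∈ N, ((-1 : ℤ) + if p i then 1 else 0) = (-1) * (if ¬ p i then 1 else 0) := by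
    intro i _
    by_cases h : p i <;> simp [h]
  rw [Finset.prod_congr rfl h2, Finset.prod_mul_distrib, Finset.prod_const, Finset.prod_boole,
    Finset.prod_boole, mul_assoc, pds_ite]
  congr 1
  apply if_congr _ rfl rfl
  constructor
  · intro h
    exact ⟨fun i hi => (h i).2 hi, fun i hi => (h i).1 (Finset.mem_compl.1 hi)⟩
  · rintro ⟨h1, h2⟩ i
    exact ⟨fun hi => h2 i (Finset.mem_compl.2 hi), fun hi => h1 i hi⟩

/-- The polarized sum does not depend on the generic functional (Brianchon-Gram). -/
lemma pds_sum {d : ℕ} (T : Finset (Fin d → ℚ)) (hT : T.Nonempty)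
    (V : Finset (Fin d → ℚ))
    (hV : ∀ v, v ∈ V ↔ IsVertex (convexHull ℚ (T : Set (Fin d → ℚ))) v)
    (B : (Fin d → ℚ) → Module.Basis (Fin d) ℚ (Fin d → ℚ))
    (hG : ∀ v ∈ V, PdsGood (convexHull ℚ (T : Set (Fin d → ℚ))) v (B v))
    (ξ : Module.Dual ℚ (Fin d → ℚ)) (hξ : ∀ v ∈ V, ∀ i, ξ (B v i) ≠ 0) (x : Fin d → ℚ) :
    ∑ v ∈ V, (-1 : ℤ) ^ (Finset.univ.filter fun i => ξ (B v i) < 0).card *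
      (if (∀ i, (i ∉ (Finset.univ.filter fun i => ξ (B v i) < 0) → 0 ≤ (B v).repr (x - v) i) ∧
        (i ∈ (Finset.univ.filter fun i => ξ (B v i) < 0) → ¬ 0 ≤ (B v).repr (x - v) i))
        then 1 else 0) =
    ∑ F ∈ (V ×ˢ (Finset.univ : Finset (Finset (Fin d)))).image
        (fun p => pdsFace (convexHull ℚ (T : Set (Fin d → ℚ))) p.1 (B p.1) p.2),
      (-1 : ℤ) ^ (Module.finrank ℚ (vectorSpan ℚ F)) *
        (if pdsTan (convexHull ℚ (T : Set (Fin d → ℚ))) F x then 1 else 0) := by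
  set P := convexHull ℚ (T : Set (Fin d → ℚ)) with hPdef
  let N : (Fin d → ℚ) → Finset (Fin d) := fun v => Finset.univ.filter fun i => ξ (B v i) < 0
  have hN : ∀ v i, i ∈ N v ↔ ξ (B v i) < 0 := fun v i => by simp [N]
  have himg : (V ×ˢ (Finset.univ : Finset (Finset (Fin d)))).image
        (fun p => pdsFace P p.1 (B p.1) p.2) =
      (V.sigma fun v => (N v).powerset).image (fun p => pdsFace P p.1 (B p.1) p.2) := by
    ext F
    simp only [Finset.mem_image, Finset.mem_product, Finset.mem_sigma, Finset.mem_univ, and_true,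
      Finset.mem_powerset]
    constructor
    · rintro ⟨⟨v, J⟩, hv, rfl⟩
      dsimp only at hv ⊢
      have hF := (hG v hv).isFace J
      have hvF := (hG v hv).base_mem J
      obtain ⟨ℓ, hℓ⟩ := id hF
      obtain ⟨w, hw, hwP, hw1, hw2⟩ := pds_exists_vertex T hT ℓ ξ
      have hwV := (hV w).2 hw
      have hwF : w ∈ pdsFace P v (B v) J := by rw [hℓ]; exact ⟨hwP, hw1⟩
      obtain ⟨K, hK⟩ := (hG w hwV).face_eq hF hwF
      refine ⟨⟨w, K⟩, ⟨hwV, fun k hk => ?_⟩, hK.symm⟩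
      rw [hN]
      refine lt_of_le_of_ne ?_ (hξ w hwV k)
      obtain ⟨δ, hδ, hm⟩ := (hG w hwV).edge_mem K hk
      rw [← hK, hℓ] at hm
      have h3 := hw2 _ hm.1 (le_antisymm (hw1 _ hm.1) (hm.2 w hwP))
      rw [map_add, map_smul, smul_eq_mul] at h3
      by_contra hc
      push Not at hc
      have := mul_pos hδ hc
      linarith
    · rintro ⟨⟨v, J⟩, ⟨hv, -⟩, rfl⟩
      exact ⟨(v, J), hv, rfl⟩
  rw [himg, Finset.sum_image, Finset.sum_sigma]
  · refine Finset.sum_congr rfl fun v hv => ?_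
    refine Eq.trans ?_ ((pds_sign (N v) (fun i => 0 ≤ (B v).repr (x - v) i)).trans ?_)
    · congr 1
    refine Finset.sum_congr rfl fun J _ => ?_
    dsimp only
    rw [(hG v hv).finrank_eq J]
    congr 1
    exact if_congr ((hG v hv).tan_iff J x).symm rfl rfl
  · rintro ⟨v, J⟩ hp ⟨w, K⟩ hq he
    simp only [Finset.coe_sigma, Set.mem_sigma_iff, Finset.mem_coe, Finset.mem_powerset] at hp hq
    dsimp only at he
    have h1 : ∀ y ∈ pdsFace P v (B v) J, ξ v ≤ ξ y → y = v := fun y hy =>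
      (hG v hp.1).unique_max ξ (fun j hj => (hN v j).1 (hp.2 hj)) hy
    have h2 : ∀ y ∈ pdsFace P w (B w) K, ξ w ≤ ξ y → y = w := fun y hy =>
      (hG w hq.1).unique_max ξ (fun j hj => (hN w j).1 (hq.2 hj)) hy
    have hv := (hG v hp.1).base_mem J
    have hw := (hG w hq.1).base_mem K
    have hvw : v = w := by
      rcases le_total (ξ v) (ξ w) with h | h
      · exact (h1 w (by rw [he]; exact hw) h).symm
      · exact h2 v (by rw [← he]; exact hv) h
    subst hvw
    have : J = K := Finset.Subset.antisymm ((hG v hp.1).face_subset he)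
      ((hG v hp.1).face_subset he.symm)
    rw [this]

lemma pds_good {d : ℕ} {P : Set (Fin d → ℚ)} {v : Fin d → ℚ}
    (b : Module.Basis (Fin d) ℚ (Fin d → ℚ)) (hv : IsVertex P v)
    (h : tangentCone P {v} = simpleCone v b) : PdsGood P v b := by
  have hvP : v ∈ P := by
    obtain ⟨ℓ, hℓ⟩ := hv
    have : v ∈ ({v} : Set (Fin d → ℚ)) := rfl
    rw [hℓ] at this
    exact this.1
  refine ⟨hvP, fun y hy i => ?_, fun i => ?_⟩
  · have hy' : y ∈ tangentCone P {v} :=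
      ⟨v, rfl, y - v, by simp, 1, one_pos, by simpa using hy⟩
    rw [h] at hy'
    obtain ⟨lam, hlam, rfl⟩ := hy'
    rw [add_sub_cancel_left, b.repr_sum_self]
    exact hlam i
  · have : v + b i ∈ tangentCone P {v} := by
      rw [h]
      refine ⟨Pi.single i 1, fun j => ?_, ?_⟩
      · by_cases hj : j = i
        · subst hj; simp
        · simp [hj]
      · simp [Pi.single_apply]
    obtain ⟨f, hf, z, hz, ε, hε, hm⟩ := this
    rw [Set.mem_singleton_iff] at hf
    subst hf
    have : b i = z := add_left_cancel hz
    exact ⟨ε, hε, this ▸ hm⟩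

lemma pds_polar {d : ℕ} (b : Module.Basis (Fin d) ℚ (Fin d → ℚ)) (v x : Fin d → ℚ)
    (ξ : Module.Dual ℚ (Fin d → ℚ)) (hξ : ∀ i, ξ (b i) ≠ 0) :
    x ∈ polarizedCone v b ξ ↔
    (∀ i, (i ∉ (Finset.univ.filter fun i => ξ (b i) < 0) → 0 ≤ b.repr (x - v) i) ∧
        (i ∈ (Finset.univ.filter fun i => ξ (b i) < 0) → ¬ 0 ≤ b.repr (x - v) i)) := by
  simp only [Finset.mem_filter, Finset.mem_univ, true_and, not_lt, not_le]
  constructor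
  · rintro ⟨lam, rfl, h⟩ i
    rw [add_sub_cancel_left, b.repr_sum_self]
    exact ⟨fun hi => (h i).1 (lt_of_le_of_ne hi (hξ i).symm), (h i).2⟩
  · intro h
    refine ⟨fun i => b.repr (x - v) i, ?_, fun i => ⟨fun hi => (h i).1 hi.le, (h i).2⟩⟩
    rw [b.sum_repr]; simp

/-- **Polar decomposition of a simple polytope (Lawrence–Varchenko)**. -/
theorem polar_decomposition_simple {d : ℕ} (hd : 1 ≤ d) (P : Set (Fin d → ℚ))
    (hP : IsPolytope P) (hfull : affineSpan ℚ P = ⊤)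
    (t : (Fin d → ℚ) → Fin d → Fin d → ℚ) (hsimple : IsSimpleWith P t)
    (ξ : Module.Dual ℚ (Fin d → ℚ))
    (hgen : ∀ v, IsVertex P v → ∀ i, ξ (t v i) ≠ 0) :
    ∀ x : Fin d → ℚ,
      indicator P x =
        ∑ᶠ v ∈ {v : Fin d → ℚ | IsVertex P v},
          (-1 : ℤ) ^ indAt ξ (t v) * indicator (polarizedCone v (t v) ξ) x := by
  obtain ⟨T, rfl⟩ := hP
  have : Nonempty (Fin d) := ⟨⟨0, hd⟩⟩
  have hT : T.Nonempty := by
    rw [Finset.nonempty_iff_ne_empty]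
    rintro rfl
    simp at hfull
  set P := convexHull ℚ (T : Set (Fin d → ℚ)) with hPdef
  have hVfin : {v | IsVertex P v}.Finite :=
    T.finite_toSet.subset fun v hv => pds_vertex_mem hv
  let V : Finset (Fin d → ℚ) := hVfin.toFinset
  have hV : ∀ v, v ∈ V ↔ IsVertex P v := fun v => by simp [V]
  let B : (Fin d → ℚ) → Module.Basis (Fin d) ℚ (Fin d → ℚ) := fun v =>
    if h : LinearIndependent ℚ (t v) then basisOfLinearIndependentOfCardEqFinrank h (by simp)
    else Pi.basisFun ℚ (Fin d)
  have hB : ∀ v, v ∈ V → ⇑(B v) = t v := by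
    intro v hv
    have h := (hsimple v ((hV v).1 hv)).1
    simp only [B, dif_pos h]
    exact coe_basisOfLinearIndependentOfCardEqFinrank _ _
  have hG : ∀ v ∈ V, PdsGood P v (B v) := by
    intro v hv
    refine pds_good (B v) ((hV v).1 hv) ?_
    rw [hB v hv]
    exact (hsimple v ((hV v).1 hv)).2
  have hξ : ∀ v ∈ V, ∀ i, ξ (B v i) ≠ 0 := by
    intro v hv i
    rw [hB v hv]
    exact hgen v ((hV v).1 hv) i
  intro x
  have hsum : ∑ᶠ v ∈ {v : Fin d → ℚ | IsVertex P v},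
      (-1 : ℤ) ^ indAt ξ (t v) * indicator (polarizedCone v (t v) ξ) x =
      ∑ v ∈ V, (-1 : ℤ) ^ indAt ξ (B v) * indicator (polarizedCone v (B v) ξ) x := by
    rw [finsum_mem_eq_finite_toFinset_sum _ hVfin]
    refine Finset.sum_congr rfl fun v hv => ?_
    rw [hB v hv]
  rw [hsum]
  by_cases hx : x ∈ P
  · rw [indicator, if_pos hx]
    obtain ⟨w, hw, hwP, -, hw2⟩ := pds_exists_vertex T hT 0 (-ξ)
    have hwV := (hV w).2 hw
    have hpos : ∀ i, 0 < ξ (B w i) := by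
      intro i
      refine lt_of_le_of_ne ?_ (hξ w hwV i).symm
      obtain ⟨δ, hδ, hm⟩ := (hG w hwV).edge i
      have h3 := hw2 _ hm rfl
      rw [map_add, map_smul, smul_eq_mul, LinearMap.neg_apply, LinearMap.neg_apply] at h3
      by_contra hc
      push Not at hc
      have := mul_neg_of_pos_of_neg hδ hc
      linarith
    rw [Finset.sum_eq_single_of_mem w hwV]
    · have h1 : indAt ξ (B w) = 0 := by
        rw [indAt, Finset.card_eq_zero, Finset.filter_eq_empty_iff]
        intro i _
        exact not_lt.2 (hpos i).le
      rw [h1, pow_zero, one_mul, indicator, if_pos]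
      rw [pds_polar _ _ _ _ (hξ w hwV)]
      intro i
      refine ⟨fun _ => (hG w hwV).nonneg x hx i, fun hi => ?_⟩
      exact absurd (Finset.mem_filter.1 hi).2 (not_lt.2 (hpos i).le)
    · intro v hv hvw
      rw [indicator, if_neg, mul_zero]
      rw [pds_polar _ _ _ _ (hξ v hv)]
      intro hall
      apply hvw
      symm
      refine (hG v hv).unique_max (J := Finset.univ) (-ξ) (fun j _ => ?_)
        (y := w) ⟨hwP, fun i hi => absurd (Finset.mem_univ i) hi⟩ ?_
      · have h4 : ¬ ξ (B v j) < 0 := fun hlt =>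
          (hall j).2 (Finset.mem_filter.2 ⟨Finset.mem_univ j, hlt⟩) ((hG v hv).nonneg x hx j)
        have h5 := lt_of_le_of_ne (not_lt.1 h4) (hξ v hv j).symm
        simpa using h5
      · exact hw2 v (hG v hv).mem rfl
  · rw [indicator, if_neg hx]
    symm
    have hind : ∃ c : ℤ, ∀ ζ : Module.Dual ℚ (Fin d → ℚ), (∀ v ∈ V, ∀ i, ζ (B v i) ≠ 0) →
        ∑ v ∈ V, (-1 : ℤ) ^ indAt ζ (B v) * indicator (polarizedCone v (B v) ζ) x = c := by
      refine ⟨_, fun ζ hζ => Eq.trans (Finset.sum_congr rfl fun v hv => ?_)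
        (pds_sum T hT V hV B hG ζ hζ x)⟩
      rw [indAt, indicator]
      congr 1
      exact if_congr (pds_polar (B v) v x ζ (hζ v hv)) rfl rfl
    obtain ⟨η, hη⟩ := pds_sep T x hx
    -- perturb the separating functional into a generic one
    obtain ⟨ε, hε, hεs⟩ := pds_eps (T.disjSum (V ×ˢ (Finset.univ : Finset (Fin d))))
      (Sum.elim (fun a => η a - η x) (fun p => η (B p.1 p.2)))
      (Sum.elim (fun a => ξ a - ξ x) (fun p => ξ (B p.1 p.2)))
    have hex : ∃ ζ : Module.Dual ℚ (Fin d → ℚ), (∀ a ∈ T, ζ x < ζ a) ∧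
        ∀ v ∈ V, ∀ i, ζ (B v i) ≠ 0 := by
      refine ⟨η + ε • ξ, fun a ha => ?_, fun v hv i => ?_⟩
      · have h0 : 0 < η a - η x := sub_pos.2 (hη a ha)
        have h1 := (hεs (Sum.inl a) (Finset.inl_mem_disjSum.2 ha) h0.ne').1 h0
        simp only [Sum.elim_inl] at h1
        simp only [LinearMap.add_apply, LinearMap.smul_apply, smul_eq_mul]
        linarith
      · simp only [LinearMap.add_apply, LinearMap.smul_apply, smul_eq_mul]
        by_cases h0 : η (B v i) = 0
        · rw [h0, zero_add]
          exact mul_ne_zero hε.ne' (hξ v hv i)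
        · exact (hεs (Sum.inr (v, i)) (Finset.inr_mem_disjSum.2
            (Finset.mk_mem_product hv (Finset.mem_univ i))) h0).2
    obtain ⟨c, hind⟩ := hind
    obtain ⟨ζ, hζT, hζ⟩ := hex
    rw [hind ξ hξ, ← hind ζ hζ]
    refine Finset.sum_eq_zero fun v hv => ?_
    rw [indicator, if_neg, mul_zero]
    rintro ⟨lam, hlam, hs⟩
    have h3 : 0 ≤ ∑ i, lam i * ζ (B v i) := by
      refine Finset.sum_nonneg fun i _ => ?_
      rcases lt_or_gt_of_ne (hζ v hv i) with h | h
      · exact mul_nonneg_of_nonpos_of_nonpos ((hs i).2 h).le h.le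
      · exact mul_nonneg ((hs i).1 h) h.le
    have h4 := hζT v (pds_vertex_mem ((hV v).1 hv))
    rw [hlam, map_add, map_sum] at h4
    simp only [map_smul, smul_eq_mul] at h4
    linarith
end
end

section
/- Triangulation-independence of the local contribution: Let P ⊆ ℚ^d be a full-dimensional polytope, v a vertex with normal cone N_v, and let Δ and Δ′ be two regular triangulations of N_v into simplicial cones. Let ξ ∈ (ℚ^d)^* be generic for both Δ and Δ′. Then the local contributions coincide: 1^ξ_{Δ,v} = 1^ξ_{Δ′,v} as functions ℚ^d → ℤ. -/
noncomputable section
open Classical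

open scoped BigOperators

/-- The (inner) normal cone of `P` at `v`, inside the dual space. -/
def normalCone {d : ℕ} (P : Set (Fin d → ℚ)) (v : Fin d → ℚ) :
    Set (Module.Dual ℚ (Fin d → ℚ)) :=
  {n | ∀ x ∈ P, n v ≤ n x}

/-- The simplicial cone in the dual space spanned by `w_1, …, w_d`. -/
def coneOf {d : ℕ} (w : Fin d → Module.Dual ℚ (Fin d → ℚ)) :
    Set (Module.Dual ℚ (Fin d → ℚ)) :=
  {n | ∃ c : Fin d → ℚ, (∀ k, 0 ≤ c k) ∧ n = ∑ k, c k • w k}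

/-- The face of the simplicial cone spanned by `w` where the coordinates in `K`
vanish. -/
def coneFaceOf {d : ℕ} (w : Fin d → Module.Dual ℚ (Fin d → ℚ)) (K : Finset (Fin d)) :
    Set (Module.Dual ℚ (Fin d → ℚ)) :=
  {n | ∃ c : Fin d → ℚ, (∀ k, 0 ≤ c k) ∧ (∀ k ∈ K, c k = 0) ∧ n = ∑ k, c k • w k}

/-- A finite collection of simplicial cones in the dual space, each given by `d`
linearly independent generators. -/
structure SimplicialFamily (d : ℕ) where
  M : ℕ
  w : Fin M → Fin d → Module.Dual ℚ (Fin d → ℚ)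
  indep : ∀ i, LinearIndependent ℚ (w i)

/-- `Δ` is a triangulation of `N`: the cones cover `N` and any two of them intersect
in a common face. -/
def IsTriangulationOf {d : ℕ} (Δ : SimplicialFamily d)
    (N : Set (Module.Dual ℚ (Fin d → ℚ))) : Prop :=
  (⋃ i, coneOf (Δ.w i)) = N ∧
  ∀ i j, ∃ K K' : Finset (Fin d),
    coneOf (Δ.w i) ∩ coneOf (Δ.w j) = coneFaceOf (Δ.w i) K ∧
    coneOf (Δ.w i) ∩ coneOf (Δ.w j) = coneFaceOf (Δ.w j) K'

/-- `Δ` is regular on `N`: there is a convex function on `N` that is linear on each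
cone of `Δ`, with pairwise distinct linear pieces. -/
def IsRegularOn {d : ℕ} (Δ : SimplicialFamily d)
    (N : Set (Module.Dual ℚ (Fin d → ℚ))) : Prop :=
  ∃ h : Module.Dual ℚ (Fin d → ℚ) → ℚ, ConvexOn ℚ N h ∧
    ∃ ℓ : Fin Δ.M → Module.Dual ℚ (Module.Dual ℚ (Fin d → ℚ)),
      (∀ i, ∀ n ∈ coneOf (Δ.w i), h n = ℓ i n) ∧
      ∀ i j, i ≠ j → ℓ i ≠ ℓ j

/-- The polarized cone `T^ξ_v T_σ` for a simplicial cone with generators `w` and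
coordinates `α` of `ξ` in the basis `w`. -/
def polarCone {d : ℕ} (v : Fin d → ℚ) (w : Fin d → Module.Dual ℚ (Fin d → ℚ))
    (α : Fin d → ℚ) : Set (Fin d → ℚ) :=
  {x | ∀ k, (0 < α k → w k v ≤ w k x) ∧ (α k < 0 → w k x < w k v)}

/-- The index: the number of negative coordinates. -/
def indOf {d : ℕ} (α : Fin d → ℚ) : ℕ :=
  (Finset.univ.filter fun k => α k < 0).card

/-- The local contribution `1^ξ_{Δ,v}` at `v`, where `α i` gives the coordinates of
`ξ` in the basis `Δ.w i`. -/
def localContrib {d : ℕ} (Δ : SimplicialFamily d) (v : Fin d → ℚ)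
    (α : Fin Δ.M → Fin d → ℚ) (x : Fin d → ℚ) : ℤ :=
  ∑ i, (-1 : ℤ) ^ indOf (α i) * indicator (polarCone v (Δ.w i) (α i)) x

/-- Indicator of positivity, as an integer. -/
def posZ (q : ℚ) : ℤ := if 0 < q then 1 else 0

/-- Indicator of negativity, as an integer. -/
def negZ (q : ℚ) : ℤ := if q < 0 then 1 else 0

lemma exists_avoid {V : Type} [AddCommGroup V] [Module ℚ V]
    (Φ : Finset (Module.Dual ℚ V)) : ∃ η : V, ∀ φ ∈ Φ, φ ≠ 0 → φ η ≠ 0 := by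
  obtain ⟨x, hx⟩ := Module.Dual.exists_forall_ne_zero_of_forall_exists
    (K := ℚ) (M := V) (ι := {φ : Φ // (φ : Module.Dual ℚ V) ≠ 0}) (fun φ => (φ.1 : Module.Dual ℚ V))
    (fun φ => by
      by_contra hcon
      push Not at hcon
      exact φ.2 (LinearMap.ext fun x => by simpa using hcon x))
  exact ⟨x, fun φ hφ h0 => hx ⟨⟨φ, hφ⟩, h0⟩⟩

/-- Signs of nonvanishing functionals are stable under small perturbations. -/
lemma exists_small_s11 {V : Type} [AddCommGroup V] [Module ℚ V]
    (Φ : Finset (Module.Dual ℚ V)) (z η : V) :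
    ∃ ε : ℚ, 0 < ε ∧ ∀ φ ∈ Φ, φ z ≠ 0 → ∀ e : ℚ, |e| ≤ ε →
      φ (z + e • η) ≠ 0 ∧ posZ (φ (z + e • η)) = posZ (φ z) ∧
        negZ (φ (z + e • η)) = negZ (φ z) := by
  induction Φ using Finset.induction_on with
  | empty => exact ⟨1, one_pos, by simp⟩
  | insert ψ Φ hψ ih =>
    obtain ⟨ε, hε, h⟩ := ih
    by_cases hz : ψ z = 0
    · refine ⟨ε, hε, fun φ hφ h0 => ?_⟩
      rcases Finset.mem_insert.1 hφ with rfl | hφ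
      · exact absurd hz h0
      · exact h φ hφ h0
    · have hpos : 0 < |ψ z| := abs_pos.2 hz
      have hm : 0 < |ψ η| + 1 := by positivity
      refine ⟨min ε (|ψ z| / (|ψ η| + 1) / 2), lt_min hε (by positivity), fun φ hφ h0 e he => ?_⟩
      rcases Finset.mem_insert.1 hφ with rfl | hφ
      · have he2 := le_trans he (min_le_right _ _)
        have h1 : |e * φ η| < |φ z| := by
          rw [abs_mul]
          have : |e| * (|φ η| + 1) ≤ |φ z| / 2 := by
            calc |e| * (|φ η| + 1) ≤ (|φ z| / (|φ η| + 1) / 2) * (|φ η| + 1) := by gcongr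
              _ = |φ z| / 2 := by field_simp
          nlinarith [abs_nonneg e]
        simp only [map_add, map_smul, smul_eq_mul, posZ, negZ]
        obtain ⟨h2, h3⟩ := abs_lt.1 h1
        rcases lt_or_gt_of_ne h0 with hn | hp
        · rw [abs_of_neg hn] at h2 h3
          refine ⟨by linarith, ?_, ?_⟩
          · rw [if_neg (by linarith), if_neg (by linarith)]
          · rw [if_pos (by linarith), if_pos (by linarith)]
        · rw [abs_of_pos hp] at h2 h3
          refine ⟨by linarith, ?_, ?_⟩
          · rw [if_pos (by linarith), if_pos (by linarith)]
          · rw [if_neg (by linarith), if_neg (by linarith)]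
      · exact h φ hφ h0 e (le_trans he (min_le_left _ _))

/-- A function of a rational parameter which does not change across intervals containing at most
one break point is constant off the break points. -/
lemma walk (φ : ℚ → ℤ) (B : Finset ℚ)
    (h0 : ∀ s t, s < t → (∀ b ∈ B, ¬ (s ≤ b ∧ b ≤ t)) → φ s = φ t)
    (h1 : ∀ s b t, s < b → b < t → b ∈ B → (∀ b' ∈ B, s ≤ b' → b' ≤ t → b' = b) → φ s = φ t) :
    ∀ n : ℕ, ∀ s t, s < t → s ∉ B → t ∉ B → (B.filter fun b => s ≤ b ∧ b ≤ t).card ≤ n →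
      φ s = φ t := by
  intro n
  induction n with
  | zero =>
    intro s t hst hs ht hc
    have hem := Finset.card_eq_zero.1 (Nat.le_zero.1 hc)
    exact h0 s t hst fun b hb hh => by
      have : b ∈ (B.filter fun b => s ≤ b ∧ b ≤ t) := Finset.mem_filter.2 ⟨hb, hh⟩
      rw [hem] at this
      exact absurd this (Finset.notMem_empty b)
  | succ n ih =>
    intro s t hst hs ht hc
    by_cases hle : (B.filter fun b => s ≤ b ∧ b ≤ t).card ≤ 1
    · by_cases hemp : ∃ b ∈ B, s ≤ b ∧ b ≤ t
      · obtain ⟨b, hb, hsb, hbt⟩ := hemp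
        refine h1 s b t (lt_of_le_of_ne hsb ?_) (lt_of_le_of_ne hbt ?_) hb ?_
        · rintro rfl; exact hs hb
        · rintro rfl; exact ht hb
        · intro b' hb' h3 h4
          exact Finset.card_le_one.1 hle b' (Finset.mem_filter.2 ⟨hb', h3, h4⟩) b
            (Finset.mem_filter.2 ⟨hb, hsb, hbt⟩)
      · push Not at hemp
        exact h0 s t hst fun b hb hh => absurd hh.2 (not_le.2 (hemp b hb hh.1))
    · push Not at hle
      obtain ⟨b, hb, b', hb', hne⟩ := Finset.one_lt_card.1 hle
      wlog hbb : b < b' generalizing b b'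
      · exact this b' hb' b hb hne.symm (lt_of_le_of_ne (not_lt.1 hbb) hne.symm)
      obtain ⟨m, hm, hmB⟩ := (Set.Ioo_infinite hbb).exists_notMem_finset B
      rw [Finset.mem_filter] at hb hb'
      have e1 : φ s = φ m := by
        refine ih s m (by linarith [hm.1, hb.2.1]) hs hmB ?_
        refine Nat.le_of_lt_succ (lt_of_lt_of_le (Finset.card_lt_card ?_) hc)
        refine Finset.ssubset_iff_of_subset (fun x hx => ?_) |>.2 ⟨b', ?_, ?_⟩
        · rw [Finset.mem_filter] at hx ⊢
          exact ⟨hx.1, hx.2.1, by linarith [hm.2, hx.2.2, hb'.2.2]⟩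
        · exact Finset.mem_filter.2 hb'
        · rw [Finset.mem_filter]; intro hx; linarith [hm.2, hx.2.2]
      have e2 : φ m = φ t := by
        refine ih m t (by linarith [hm.2, hb'.2.2]) hmB ht ?_
        refine Nat.le_of_lt_succ (lt_of_lt_of_le (Finset.card_lt_card ?_) hc)
        refine Finset.ssubset_iff_of_subset (fun x hx => ?_) |>.2 ⟨b, ?_, ?_⟩
        · rw [Finset.mem_filter] at hx ⊢
          exact ⟨hx.1, by linarith [hm.1, hx.2.1, hb.2.1], hx.2.2⟩
        · exact Finset.mem_filter.2 hb
        · rw [Finset.mem_filter]; intro hx; linarith [hm.1, hx.2.1]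
      exact e1.trans e2

/-- The jump of a combination of products of signs across a wall. -/
lemma jump {V : Type} [AddCommGroup V] [Module ℚ V] {ι : Type} [Fintype ι] {d : ℕ}
    (a : ι → Fin (d + 1) → Module.Dual ℚ V) (c : ι → ℤ) (s : ι → Fin (d + 1) → ℤ)
    (Z : ι → Prop) [Fintype {i // Z i}] (kk : {i // Z i} → Fin (d + 1)) (ζ η : V) (e f : ℚ) (he : 0 < e) (hf : 0 < f)
    (h1 : ∀ i : {i // Z i}, a i (kk i) ζ = 0) (h2 : ∀ i : {i // Z i}, a i (kk i) η ≠ 0)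
    (h3 : ∀ (i : {i // Z i}) j, posZ (a i ((kk i).succAbove j) (ζ + e • η)) =
      posZ (a i ((kk i).succAbove j) ζ))
    (h4 : ∀ (i : {i // Z i}) j, posZ (a i ((kk i).succAbove j) (ζ + (-f) • η)) =
      posZ (a i ((kk i).succAbove j) ζ))
    (h5 : ∀ i, ¬ Z i → ∀ j, posZ (a i j (ζ + e • η)) = posZ (a i j (ζ + (-f) • η))) :
    (∑ i, c i * ∏ k, (posZ (a i k (ζ + e • η)) - s i k)) -
      (∑ i, c i * ∏ k, (posZ (a i k (ζ + (-f) • η)) - s i k)) =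
    ∑ i : {i // Z i}, (c i * (if 0 < a i (kk i) η then 1 else -1)) *
      ∏ j, (posZ (a i ((kk i).succAbove j) ζ) - s i ((kk i).succAbove j)) := by
  rw [← Finset.sum_sub_distrib]
  have hsub : ∀ F : ι → ℤ, (∀ i, ¬ Z i → F i = 0) → ∑ i, F i = ∑ i : {i // Z i}, F i := by
    intro F hF
    rw [← Finset.sum_subtype (Finset.univ.filter Z) (by simp) F]
    refine (Finset.sum_filter_of_ne fun i _ h => ?_).symm
    by_contra hz
    exact h (hF i hz)
  rw [hsub]
  · refine Finset.sum_congr rfl fun i _ => ?_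
    rw [Fin.prod_univ_succAbove _ (kk i), Fin.prod_univ_succAbove _ (kk i)]
    simp only [h3, h4]
    have hj : posZ (a i (kk i) (ζ + e • η)) - posZ (a i (kk i) (ζ + (-f) • η)) =
        if 0 < a i (kk i) η then 1 else -1 := by
      simp only [map_add, map_smul, smul_eq_mul, h1, zero_add, posZ]
      rcases lt_or_gt_of_ne (h2 i) with hn | hp
      · rw [if_neg (by nlinarith), if_pos (by nlinarith), if_neg (by linarith)]; rfl
      · rw [if_pos (by positivity), if_neg (by nlinarith), if_pos hp]; rfl
    rw [← hj]; ring
  · intro i hi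
    simp only [h5 i hi, sub_self]

lemma negZ_sq_aux (p q : ℚ) (hq : q ≠ 0) (h : posZ p - negZ q ≠ 0) : 0 ≤ p * q := by
  unfold posZ negZ at h
  rcases lt_or_gt_of_ne hq with hn | hp
  · rw [if_pos hn] at h
    by_cases hp : 0 < p
    · rw [if_pos hp] at h; simp at h
    · nlinarith
  · rw [if_neg (not_lt.2 hp.le)] at h
    by_cases h' : 0 < p
    · positivity
    · rw [if_neg h'] at h; simp at h

/-- An affine function without zeros on an interval has constant sign. -/
lemma posZ_affine (x m s t : ℚ) (hst : s ≤ t) (h : ∀ r, s ≤ r → r ≤ t → x - r * m ≠ 0) :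
    posZ (x - s * m) = posZ (x - t * m) := by
  have key : ¬ ((x - s * m) * (x - t * m) < 0) := by
    intro hneg
    have hm : m ≠ 0 := by
      rintro rfl
      simp only [mul_zero, sub_zero] at hneg
      nlinarith [mul_self_nonneg x]
    have hm2 : 0 < m * m := mul_self_pos.2 hm
    have e : ∀ r, x - r * m = m * (x / m - r) := fun r => by field_simp
    rw [e, e] at hneg
    have h3 : (x / m - s) * (x / m - t) < 0 := by
      by_contra hc
      push Not at hc
      nlinarith
    refine h (x / m) ?_ ?_ (by field_simp; ring)
    · by_contra hc; push Not at hc; nlinarith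
    · by_contra hc; push Not at hc; nlinarith
  have h1 := h s le_rfl hst
  have h2 := h t hst le_rfl
  unfold posZ
  rcases lt_or_gt_of_ne h1 with a1 | a1 <;> rcases lt_or_gt_of_ne h2 with a2 | a2
  · rw [if_neg (by linarith), if_neg (by linarith)]
  · exact absurd (mul_neg_of_neg_of_pos a1 a2) key
  · exact absurd (mul_neg_of_pos_of_neg a1 a2) key
  · rw [if_pos a1, if_pos a2]

theorem core (d : ℕ) : ∀ (V : Type) [AddCommGroup V] [Module ℚ V] (ι : Type) [Fintype ι]
    (w : ι → Fin d → V) (a : ι → Fin d → Module.Dual ℚ V) (c : ι → ℤ) (y : Module.Dual ℚ V)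
    (_ : ∀ i j k, a i j (w i k) = if j = k then 1 else 0)
    (_ : ∀ i ξ, ξ = ∑ k, a i k ξ • w i k)
    (_ : ∀ i k, y (w i k) ≠ 0)
    (Φ : Finset (Module.Dual ℚ V)) (_ : ∀ φ ∈ Φ, φ ≠ 0)
    (_ : ∀ ξ, (∀ φ ∈ Φ, φ ξ ≠ 0) → ∑ i, c i * ∏ k, posZ (a i k ξ) = 0)
    (ξ : V) (_ : ∀ i k, a i k ξ ≠ 0),
    ∑ i, c i * ∏ k, (posZ (a i k ξ) - negZ (y (w i k))) = 0 := by
  induction d with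
  | zero =>
    intro V _ _ ι _ w a c y _ _ _ Φ hΦ hF ξ _
    obtain ⟨η, hη⟩ := exists_avoid Φ
    simpa using hF η fun φ hφ => hη φ hφ (hΦ φ hφ)
  | succ d ih =>
    intro V _ _ ι _ w a c y hbi hrep hy Φ hΦ hF ξ hξ
    rcases isEmpty_or_nonempty ι with hι | ⟨⟨i₀⟩⟩
    · simp
    have hane : ∀ i k, a i k ≠ 0 := by
      intro i k h
      have := hbi i k k
      rw [h] at this
      simp at this
    have hyne : y ≠ 0 := by
      intro h
      exact hy i₀ 0 (by rw [h]; rfl)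
    -- a generic direction
    obtain ⟨η, hη, hηy⟩ : ∃ η : V, (∀ φ ∈ (Finset.univ.image fun p : ι × Fin (d+1) => a p.1 p.2) ∪
        (Finset.univ.image fun p : (ι × Fin (d+1)) × (ι × Fin (d+1)) =>
          (a p.1.1 p.1.2 ξ) • a p.2.1 p.2.2 - (a p.2.1 p.2.2 ξ) • a p.1.1 p.1.2), φ ≠ 0 → φ η ≠ 0) ∧
        0 < y η := by
      obtain ⟨η, hη⟩ := exists_avoid (insert y
        ((Finset.univ.image fun p : ι × Fin (d+1) => a p.1 p.2) ∪
        (Finset.univ.image fun p : (ι × Fin (d+1)) × (ι × Fin (d+1)) =>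
          (a p.1.1 p.1.2 ξ) • a p.2.1 p.2.2 - (a p.2.1 p.2.2 ξ) • a p.1.1 p.1.2)))
      have hy0 := hη y (Finset.mem_insert_self _ _) hyne
      rcases lt_or_gt_of_ne hy0 with hn | hp
      · refine ⟨-η, fun φ hφ h0 => ?_, by simpa using hn⟩
        rw [map_neg]
        exact neg_ne_zero.2 (hη φ (Finset.mem_insert_of_mem hφ) h0)
      · exact ⟨η, fun φ hφ h0 => hη φ (Finset.mem_insert_of_mem hφ) h0, hp⟩
    have haη : ∀ i k, a i k η ≠ 0 := fun i k =>
      hη _ (Finset.mem_union_left _ (Finset.mem_image.2 ⟨(i, k), Finset.mem_univ _, rfl⟩)) (hane i k)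
    have hpair : ∀ i k j l (b : ℚ), a i k (ξ + (-b) • η) = 0 → a j l (ξ + (-b) • η) = 0 →
        ∀ x, a i k ξ * a j l x = a j l ξ * a i k x := by
      intro i k j l b h1 h2
      have h3 : (a i k ξ) • a j l - (a j l ξ) • a i k = 0 := by
        by_contra hne
        refine hη _ (Finset.mem_union_right _ (Finset.mem_image.2
          ⟨((i, k), (j, l)), Finset.mem_univ _, rfl⟩)) hne ?_
        simp only [map_add, map_smul, smul_eq_mul, LinearMap.sub_apply, LinearMap.smul_apply] at *
        rw [show a i k ξ = b * a i k η by linarith, show a j l ξ = b * a j l η by linarith]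
        ring
      intro x
      have := congrArg (fun f => f x) h3
      simp only [LinearMap.sub_apply, LinearMap.smul_apply, smul_eq_mul, LinearMap.zero_apply] at this
      linarith
    set G : V → ℤ := fun x => ∑ i, c i * ∏ k, (posZ (a i k x) - negZ (y (w i k))) with hG
    let B : Finset ℚ := Finset.univ.image fun p : ι × Fin (d+1) => a p.1 p.2 ξ / a p.1 p.2 η
    have hB : ∀ b, b ∈ B ↔ ∃ i k, a i k (ξ + (-b) • η) = 0 := by
      intro b
      simp only [B, Finset.mem_image, Finset.mem_univ, true_and, Prod.exists]
      refine exists_congr fun i => exists_congr fun k => ?_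
      rw [div_eq_iff (haη i k)]
      simp only [map_add, map_smul, smul_eq_mul]
      constructor <;> intro h <;> linarith
    have hB0 : (0 : ℚ) ∉ B := by
      rw [hB]; rintro ⟨i, k, h⟩
      exact hξ i k (by simpa using h)
    have hsign : ∀ i k (s t : ℚ), s ≤ t → (∀ r : ℚ, s ≤ r → r ≤ t → a i k (ξ + (-r) • η) ≠ 0) →
        posZ (a i k (ξ + (-s) • η)) = posZ (a i k (ξ + (-t) • η)) := by
      intro i k s t hst h
      have := posZ_affine (a i k ξ) (a i k η) s t hst (fun r h1 h2 h3 => h r h1 h2 (by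
        simp only [map_add, map_smul, smul_eq_mul]; linarith))
      simpa only [map_add, map_smul, smul_eq_mul, sub_eq_add_neg, neg_mul] using this
    -- far away everything vanishes
    have hfar : ∀ t, y ξ < t * y η → G (ξ + (-t) • η) = 0 := by
      intro t ht
      refine Finset.sum_eq_zero fun i _ => ?_
      rw [mul_eq_zero]; right
      by_contra hne
      rw [← ne_eq, Finset.prod_ne_zero_iff] at hne
      have h1 := congrArg y (hrep i (ξ + (-t) • η))
      rw [map_sum] at h1
      have h2 : 0 ≤ ∑ k, y (a i k (ξ + (-t) • η) • w i k) := by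
        refine Finset.sum_nonneg fun k _ => ?_
        rw [map_smul, smul_eq_mul]
        exact negZ_sq_aux _ _ (hy i k) (hne k (Finset.mem_univ _))
      rw [← h1] at h2
      simp only [map_add, map_smul, smul_eq_mul] at h2
      linarith
    -- crossing a wall
    have hcross : ∀ s b t, s < b → b < t → b ∈ B → (∀ b' ∈ B, s ≤ b' → b' ≤ t → b' = b) →
        G (ξ + (-s) • η) = G (ξ + (-t) • η) := by
      intro s b t hsb hbt hb honly
      obtain ⟨i₁, k₁, hik⟩ := (hB b).1 hb
      set ζ := ξ + (-b) • η with hζ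
      let Z : ι → Prop := fun i => ∃ k, a i k ζ = 0
      let kk : {i // Z i} → Fin (d+1) := fun i => i.2.choose
      have hkk : ∀ i : {i // Z i}, a i (kk i) ζ = 0 := fun i => i.2.choose_spec
      let H : Submodule ℚ V := LinearMap.ker (a i₁ k₁)
      have hH : ∀ (i : {i // Z i}) x, x ∈ H ↔ a i (kk i) x = 0 := by
        intro i x
        have := hpair i₁ k₁ i (kk i) b hik (hkk i) x
        rw [LinearMap.mem_ker]
        constructor
        · intro h; rw [h, mul_zero] at this
          exact (mul_eq_zero.1 this).resolve_left (hξ _ _)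
        · intro h; rw [h, mul_zero] at this
          exact (mul_eq_zero.1 this.symm).resolve_left (hξ _ _)
      have huniq : ∀ (i : {i // Z i}) j, a i ((kk i).succAbove j) ζ ≠ 0 := by
        intro i j h
        have := hpair i _ i (kk i) b h (hkk i) (w i (kk i))
        rw [hbi, hbi, if_pos rfl, if_neg (Fin.succAbove_ne _ _), mul_zero, mul_one] at this
        exact hξ _ _ this
      have hwH : ∀ (i : {i // Z i}) j, w i ((kk i).succAbove j) ∈ H := by
        intro i j
        rw [hH i, hbi, if_neg (Fin.succAbove_ne _ _).symm]
      -- the functionals to be avoided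
      let Ψ : Finset (Module.Dual ℚ V) :=
        Φ ∪ (Finset.univ.image fun p : ι × Fin (d+1) => a p.1 p.2)
      have hΨ : ∀ i k, a i k ∈ Ψ := fun i k =>
        Finset.mem_union_right _ (Finset.mem_image.2 ⟨(i, k), Finset.mem_univ _, rfl⟩)
      have hΨ0 : ∀ φ ∈ Ψ, φ ≠ 0 := by
        intro φ hφ
        rcases Finset.mem_union.1 hφ with h | h
        · exact hΦ φ h
        · obtain ⟨p, -, rfl⟩ := Finset.mem_image.1 h
          exact hane _ _
      let Φ' : Finset (Module.Dual ℚ H) :=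
        (Ψ.image fun φ => φ.comp H.subtype).filter (fun φ => φ ≠ 0)
      have key := ih H {i // Z i} (fun i j => ⟨w i ((kk i).succAbove j), hwH i j⟩)
        (fun i j => (a i ((kk i).succAbove j)).comp H.subtype)
        (fun i => c i * (if 0 < a i (kk i) η then 1 else -1)) (y.comp H.subtype)
        (by
          intro i j k
          simp only [LinearMap.comp_apply, Submodule.subtype_apply, hbi,
            Fin.succAbove_right_inj])
        (by
          intro i x
          apply Subtype.ext
          rw [Submodule.coe_sum]
          have h1 := hrep i x.1
          rw [Fin.sum_univ_succAbove _ (kk i), (hH i x.1).1 x.2, zero_smul, zero_add] at h1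
          exact h1)
        (fun i k => hy _ _) Φ' (fun φ hφ => (Finset.mem_filter.1 hφ).2)
        (by
          rintro ⟨z, hz⟩ hgen
          have hgen' : ∀ φ ∈ Ψ, ∀ u ∈ H, φ u ≠ 0 → φ z ≠ 0 := by
            intro φ hφ u hu hne
            refine hgen (φ.comp H.subtype) (Finset.mem_filter.2 ⟨Finset.mem_image_of_mem _ hφ, ?_⟩)
            intro h0
            exact hne (congrArg (fun f => f (⟨u, hu⟩ : H)) h0)
          have hζH : ζ ∈ H := hik
          obtain ⟨ε, hε, hs⟩ := exists_small_s11 Ψ z η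
          have hav : ∀ e, |e| ≤ ε → e ≠ 0 → ∀ φ ∈ Φ, φ (z + e • η) ≠ 0 := by
            intro e he he0 φ hφ
            have hφΨ : φ ∈ Ψ := Finset.mem_union_left _ hφ
            by_cases hφz : φ z = 0
            · rw [map_add, hφz, zero_add, map_smul, smul_eq_mul]
              refine mul_ne_zero he0 fun hφη => hΦ φ hφ (LinearMap.ext fun x => ?_)
              have hx : x - (a i₁ k₁ x / a i₁ k₁ η) • η ∈ H := by
                rw [LinearMap.mem_ker, map_sub, map_smul, smul_eq_mul,
                  div_mul_cancel₀ _ (haη _ _), sub_self]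
              by_contra hne
              refine hgen' φ hφΨ _ hx ?_ hφz
              rw [map_sub, map_smul, hφη, smul_zero, sub_zero]
              exact hne
            · exact (hs φ hφΨ hφz e he).1
          have hεa : |ε| ≤ ε := by rw [abs_of_pos hε]
          have hεb : |-ε| ≤ ε := by rw [abs_neg, abs_of_pos hε]
          have hnz : ∀ (i : {i // Z i}) j, a i ((kk i).succAbove j) z ≠ 0 := fun i j =>
            hgen' _ (hΨ _ _) ζ hζH (huniq i j)
          have J := jump a c (fun _ _ => 0) Z kk z η ε ε hε hε (fun i => (hH i z).1 hz)
            (fun i => haη _ _)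
            (fun i j => (hs _ (hΨ _ _) (hnz i j) ε hεa).2.1)
            (fun i j => (hs _ (hΨ _ _) (hnz i j) (-ε) hεb).2.1)
            (fun i hi j => by
              have h0 : a i j z ≠ 0 := hgen' _ (hΨ _ _) ζ hζH fun h => hi ⟨j, h⟩
              rw [(hs _ (hΨ _ _) h0 ε hεa).2.1, (hs _ (hΨ _ _) h0 (-ε) hεb).2.1])
          simp only [sub_zero] at J
          rw [hF _ (hav ε hεa hε.ne'), hF _ (hav (-ε) hεb (neg_ne_zero.2 hε.ne')), sub_zero] at J
          exact J.symm)
        ⟨ζ, hik⟩ (fun i j => huniq i j)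
      have hnb : ∀ i k r, s ≤ r → r ≤ t → r ≠ b → a i k (ξ + (-r) • η) ≠ 0 :=
        fun i k r h1 h2 h3 h4 => h3 (honly r ((hB r).2 ⟨i, k, h4⟩) h1 h2)
      have hno : ∀ i k, a i k ζ ≠ 0 → ∀ r, s ≤ r → r ≤ t → a i k (ξ + (-r) • η) ≠ 0 := by
        intro i k h0 r h1 h2
        by_cases hr : r = b
        · rw [hr]; exact h0
        · exact hnb i k r h1 h2 hr
      have es : ζ + (b - s) • η = ξ + (-s) • η := by rw [hζ]; module
      have et : ζ + (-(t - b)) • η = ξ + (-t) • η := by rw [hζ]; module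
      have J := jump a c (fun i k => negZ (y (w i k))) Z kk ζ η (b - s) (t - b) (by linarith)
        (by linarith) hkk (fun i => haη _ _)
        (fun i j => by
          rw [es]
          exact hsign _ _ _ _ hsb.le fun r h1 h2 => hno _ _ (huniq i j) r h1 (by linarith))
        (fun i j => by
          rw [et]
          exact (hsign _ _ _ _ hbt.le fun r h1 h2 => hno _ _ (huniq i j) r (by linarith) h2).symm)
        (fun i hi j => by
          rw [es, et]
          exact hsign _ _ _ _ (by linarith) (hno _ _ fun h => hi ⟨j, h⟩))
      rw [es, et] at J
      have : G (ξ + (-s) • η) - G (ξ + (-t) • η) = 0 := J.trans key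
      linarith
    have hconst : ∀ s t, s < t → (∀ b ∈ B, ¬ (s ≤ b ∧ b ≤ t)) →
        G (ξ + (-s) • η) = G (ξ + (-t) • η) := by
      intro s t hst hno
      simp only [hG]
      refine Finset.sum_congr rfl fun i _ => ?_
      congr 1
      refine Finset.prod_congr rfl fun k _ => ?_
      rw [hsign i k s t hst.le fun r h1 h2 h3 => hno r ((hB r).2 ⟨i, k, h3⟩) ⟨h1, h2⟩]
    obtain ⟨t, ht, htB⟩ := (Set.Ioi_infinite (max 0 (y ξ / y η))).exists_notMem_finset B
    have ht1 : 0 < t := lt_of_le_of_lt (le_max_left _ _) ht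
    have ht2 : y ξ < t * y η := (div_lt_iff₀ hηy).1 (lt_of_le_of_lt (le_max_right _ _) ht)
    have hw := walk (fun t => G (ξ + (-t) • η)) B hconst hcross _ 0 t ht1 hB0 htB le_rfl
    simp only [hfar t ht2, neg_zero, zero_smul, add_zero] at hw
    exact hw

lemma exists_coords {d : ℕ} (w : Fin d → Module.Dual ℚ (Fin d → ℚ)) (hw : LinearIndependent ℚ w) :
    ∃ a : Fin d → Module.Dual ℚ (Module.Dual ℚ (Fin d → ℚ)),
      (∀ j k, a j (w k) = if j = k then 1 else 0) ∧ ∀ ξ, ξ = ∑ k, a k ξ • w k := by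
  let b := basisOfLinearIndependentOfCardEqFinrank' w hw
    (by rw [Subspace.dual_finrank_eq]; simp)
  have hb : ∀ k, b k = w k := fun k => by simp [b]
  refine ⟨fun k => b.coord k, fun j k => ?_, fun ξ => ?_⟩
  · rw [← hb, Module.Basis.coord_apply, Module.Basis.repr_self, Finsupp.single_apply]
    simp only [eq_comm]
  · conv_lhs => rw [← b.sum_repr ξ]
    exact Finset.sum_congr rfl fun k _ => by rw [hb]; rfl

lemma coords_unique {d : ℕ} {w : Fin d → Module.Dual ℚ (Fin d → ℚ)}
    {a : Fin d → Module.Dual ℚ (Module.Dual ℚ (Fin d → ℚ))}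
    (hbi : ∀ j k, a j (w k) = if j = k then 1 else 0) (c : Fin d → ℚ) (j : Fin d) :
    a j (∑ k, c k • w k) = c j := by
  simp [map_sum, hbi]

lemma mem_coneOf_iff {d : ℕ} {w : Fin d → Module.Dual ℚ (Fin d → ℚ)}
    {a : Fin d → Module.Dual ℚ (Module.Dual ℚ (Fin d → ℚ))}
    (hbi : ∀ j k, a j (w k) = if j = k then 1 else 0) (hrep : ∀ ξ, ξ = ∑ k, a k ξ • w k)
    (ξ : Module.Dual ℚ (Fin d → ℚ)) : ξ ∈ coneOf w ↔ ∀ k, 0 ≤ a k ξ := by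
  constructor
  · rintro ⟨c, hc, rfl⟩ k
    rw [coords_unique hbi]; exact hc k
  · intro h
    exact ⟨fun k => a k ξ, h, hrep ξ⟩

lemma prod_posZ {d : ℕ} (q : Fin d → ℚ) : ∏ k, posZ (q k) = if ∀ k, 0 < q k then 1 else 0 := by
  unfold posZ
  rw [Fintype.prod_boole]
  congr

/-- The open cones of a regular triangulation tile the cone generically. -/
lemma tiling {d : ℕ} (Δ : SimplicialFamily d) (N : Set (Module.Dual ℚ (Fin d → ℚ)))
    (hΔ : IsTriangulationOf Δ N) (hreg : IsRegularOn Δ N)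
    (a : Fin Δ.M → Fin d → Module.Dual ℚ (Module.Dual ℚ (Fin d → ℚ)))
    (hbi : ∀ i j k, a i j (Δ.w i k) = if j = k then 1 else 0)
    (hrep : ∀ i ξ, ξ = ∑ k, a i k ξ • Δ.w i k)
    (ξ : Module.Dual ℚ (Fin d → ℚ)) (hξ : ∀ i k, a i k ξ ≠ 0) :
    ∑ i, ∏ k, posZ (a i k ξ) = if ξ ∈ N then 1 else 0 := by
  obtain ⟨h, -, ℓ, hℓ, hne⟩ := hreg
  have hmem : ∀ i, ξ ∈ coneOf (Δ.w i) ↔ ∀ k, 0 < a i k ξ := by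
    intro i
    rw [mem_coneOf_iff (hbi i) (hrep i)]
    exact forall_congr' fun k => ⟨fun h => lt_of_le_of_ne h (hξ i k).symm, le_of_lt⟩
  have huniq : ∀ i j, ξ ∈ coneOf (Δ.w i) → ξ ∈ coneOf (Δ.w j) → i = j := by
    intro i j hi hj
    obtain ⟨K, -, hK, -⟩ := hΔ.2 i j
    have hKe : ∀ k, k ∉ K := by
      intro k hk
      have : ξ ∈ coneFaceOf (Δ.w i) K := hK ▸ ⟨hi, hj⟩
      obtain ⟨c, -, hc0, hc⟩ := this
      have h1 := coords_unique (hbi i) c k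
      rw [← hc, hc0 k hk] at h1
      exact hξ i k h1
    by_contra hij
    refine hne i j hij (LinearMap.ext fun n => ?_)
    have hwk : ∀ k, ℓ i (Δ.w i k) = ℓ j (Δ.w i k) := by
      intro k
      have hin : Δ.w i k ∈ coneFaceOf (Δ.w i) K := by
        refine ⟨fun l => if l = k then 1 else 0, fun l => ?_, fun l hl => absurd hl (hKe l), ?_⟩
        · dsimp only; split_ifs <;> norm_num
        · simp
      rw [← hK] at hin
      rw [← hℓ i _ hin.1, ← hℓ j _ hin.2]
    rw [hrep i n]
    simp only [map_sum, map_smul, hwk]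
  simp only [prod_posZ, ← hmem]
  have hN : ξ ∈ N ↔ ∃ i, ξ ∈ coneOf (Δ.w i) := by rw [← hΔ.1]; simp
  by_cases hx : ξ ∈ N
  · obtain ⟨i, hi⟩ := hN.1 hx
    rw [if_pos hx, Finset.sum_eq_single i, if_pos hi]
    · intro j _ hji
      exact if_neg fun hj => hji (huniq j i hj hi)
    · simp
  · rw [if_neg hx]
    exact Finset.sum_eq_zero fun i _ => if_neg fun hi => hx (hN.2 ⟨i, hi⟩)

lemma term_eq {d : ℕ} (v x : Fin d → ℚ) (w : Fin d → Module.Dual ℚ (Fin d → ℚ)) (α : Fin d → ℚ)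
    (hα : ∀ k, α k ≠ 0) :
    (-1 : ℤ) ^ indOf α * indicator (polarCone v w α) x =
      ∏ k, (posZ (α k) - negZ (w k (x - v))) := by
  have h1 : (-1 : ℤ) ^ indOf α = ∏ k, (if α k < 0 then (-1 : ℤ) else 1) := by
    rw [indOf, Finset.prod_ite, Finset.prod_const, Finset.prod_const_one, mul_one]
  have h2 : indicator (polarCone v w α) x =
      ∏ k, (if (0 < α k → w k v ≤ w k x) ∧ (α k < 0 → w k x < w k v) then (1 : ℤ) else 0) := by
    rw [Fintype.prod_boole]
    unfold indicator
    by_cases h : x ∈ polarCone v w α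
    · rw [if_pos h]; exact (if_pos h).symm
    · rw [if_neg h]; exact (if_neg h).symm
  rw [h1, h2, ← Finset.prod_mul_distrib]
  refine Finset.prod_congr rfl fun k _ => ?_
  unfold posZ negZ
  rw [map_sub]
  rcases lt_or_gt_of_ne (hα k) with hn | hp
  · have hn' : ¬ 0 < α k := not_lt.2 hn.le
    by_cases hw : w k x < w k v
    · have : w k x - w k v < 0 := by linarith
      simp [hn, hn', hw, this]
    · have : ¬ (w k x - w k v < 0) := by linarith
      simp [hn, hn', hw, this]
  · have hp' : ¬ α k < 0 := not_lt.2 hp.le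
    by_cases hw : w k x < w k v
    · have : w k x - w k v < 0 := by linarith
      simp [hp, hp', hw, this]
    · have h3 : ¬ (w k x - w k v < 0) := by linarith
      have h4 : w k v ≤ w k x := not_lt.1 hw
      simp [hp, hp', h4, hw]

/-- A point in the interior of the tangent cone. -/
lemma exists_interior {d : ℕ} (P : Set (Fin d → ℚ)) (hP : IsPolytope P)
    (hfull : affineSpan ℚ P = ⊤) (v : Fin d → ℚ) (hvP : v ∈ P) :
    ∃ p : Fin d → ℚ, ∀ n ∈ normalCone P v, n ≠ 0 → 0 < n p := by
  obtain ⟨T, rfl⟩ := hP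
  refine ⟨∑ t ∈ T, (t - v), fun n hn hn0 => ?_⟩
  have hT : ∀ t ∈ T, 0 ≤ n t - n v := fun t ht => by
    have := hn t (subset_convexHull ℚ _ ht)
    linarith
  simp only [map_sum, map_sub]
  refine lt_of_le_of_ne (Finset.sum_nonneg hT) fun h0 => hn0 ?_
  have hz := (Finset.sum_eq_zero_iff_of_nonneg hT).1 h0.symm
  rw [affineSpan_convexHull] at hfull
  have hle : affineSpan ℚ (T : Set (Fin d → ℚ)) ≤
      AffineSubspace.mk' v (LinearMap.ker n) := by
    rw [affineSpan_le]
    intro t ht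
    rw [SetLike.mem_coe, AffineSubspace.mem_mk', LinearMap.mem_ker, vsub_eq_sub, map_sub]
    exact hz t ht
  rw [hfull] at hle
  refine LinearMap.ext fun u => ?_
  have := hle (AffineSubspace.mem_top ℚ _ (u + v))
  rw [AffineSubspace.mem_mk', LinearMap.mem_ker, vsub_eq_sub, add_sub_cancel_right] at this
  exact this

/-- **Triangulation-independence of the local contribution**: for two regular
triangulations `Δ, Δ'` of the normal cone at a vertex `v` and a functional `ξ`
generic for both, the local contributions coincide. -/
theorem local_contribution_independent {d : ℕ} (hd : 1 ≤ d) (P : Set (Fin d → ℚ))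
    (hP : IsPolytope P) (hfull : affineSpan ℚ P = ⊤)
    (v : Fin d → ℚ) (hv : IsVertex P v)
    (Δ Δ' : SimplicialFamily d)
    (hΔ : IsTriangulationOf Δ (normalCone P v)) (hreg : IsRegularOn Δ (normalCone P v))
    (hΔ' : IsTriangulationOf Δ' (normalCone P v)) (hreg' : IsRegularOn Δ' (normalCone P v))
    (ξ : Module.Dual ℚ (Fin d → ℚ))
    (α : Fin Δ.M → Fin d → ℚ) (hα : ∀ i, ξ = ∑ k, α i k • Δ.w i k)
    (α' : Fin Δ'.M → Fin d → ℚ) (hα' : ∀ i, ξ = ∑ k, α' i k • Δ'.w i k)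
    (hgen : ∀ i k, α i k ≠ 0) (hgen' : ∀ i k, α' i k ≠ 0) :
    ∀ x : Fin d → ℚ, localContrib Δ v α x = localContrib Δ' v α' x := by
  intro x
  have hvP : v ∈ P := by
    obtain ⟨ℓ, hℓ⟩ := hv
    have : v ∈ ({v} : Set (Fin d → ℚ)) := rfl
    rw [hℓ] at this
    exact this.1
  obtain ⟨p, hp⟩ := exists_interior P hP hfull v hvP
  let W : (Fin Δ.M ⊕ Fin Δ'.M) → Fin d → Module.Dual ℚ (Fin d → ℚ) := Sum.elim Δ.w Δ'.w
  let A : (Fin Δ.M ⊕ Fin Δ'.M) → Fin d → ℚ := Sum.elim α α'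
  let C : (Fin Δ.M ⊕ Fin Δ'.M) → ℤ := Sum.elim (fun _ => 1) (fun _ => -1)
  have hWind : ∀ i, LinearIndependent ℚ (W i) := by
    rintro (i | i)
    · exact Δ.indep i
    · exact Δ'.indep i
  have hWN : ∀ i k, W i k ∈ normalCone P v := by
    have hself : ∀ (w : Fin d → Module.Dual ℚ (Fin d → ℚ)) k, w k ∈ coneOf w := fun w k =>
      ⟨fun l => if l = k then 1 else 0, fun l => by dsimp only; split_ifs <;> norm_num, by simp⟩
    rintro (i | i) k
    · rw [← hΔ.1]; exact Set.mem_iUnion.2 ⟨i, hself _ k⟩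
    · rw [← hΔ'.1]; exact Set.mem_iUnion.2 ⟨i, hself _ k⟩
  have hAξ : ∀ i, ξ = ∑ k, A i k • W i k := by
    rintro (i | i)
    · exact hα i
    · exact hα' i
  have hA0 : ∀ i k, A i k ≠ 0 := by
    rintro (i | i)
    · exact hgen i
    · exact hgen' i
  choose a hbi hrep using fun i => exists_coords (W i) (hWind i)
  have haA : ∀ i k, a i k ξ = A i k := fun i k => by
    rw [hAξ i, coords_unique (hbi i)]
  -- perturb `x - v` into the interior of the tangent cone
  obtain ⟨ε, hε, hs⟩ := exists_small_s11
    (Finset.univ.image fun q : (Fin Δ.M ⊕ Fin Δ'.M) × Fin d => W q.1 q.2) (x - v) p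
  have hsgn : ∀ i k, W i k (x - v + ε • p) ≠ 0 ∧
      negZ (W i k (x - v + ε • p)) = negZ (W i k (x - v)) := by
    intro i k
    by_cases h0 : W i k (x - v) = 0
    · have hpos : 0 < ε * W i k p := mul_pos hε (hp _ (hWN i k) ((hWind i).ne_zero k))
      rw [map_add, h0, zero_add, map_smul, smul_eq_mul]
      refine ⟨hpos.ne', ?_⟩
      unfold negZ
      rw [if_neg (not_lt.2 hpos.le), if_neg (lt_irrefl _)]
    · have := hs _ (Finset.mem_image.2 ⟨(i, k), Finset.mem_univ _, rfl⟩) h0 ε (abs_of_pos hε).le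
      exact ⟨this.1, this.2.2⟩
  have main := core d (Module.Dual ℚ (Fin d → ℚ)) (Fin Δ.M ⊕ Fin Δ'.M) W a C
    (Module.Dual.eval ℚ (Fin d → ℚ) (x - v + ε • p)) hbi hrep (fun i k => (hsgn i k).1)
    (Finset.univ.image fun q : (Fin Δ.M ⊕ Fin Δ'.M) × Fin d => a q.1 q.2)
    (by
      intro φ hφ h0
      obtain ⟨q, -, rfl⟩ := Finset.mem_image.1 hφ
      have := hbi q.1 q.2 q.2
      rw [h0] at this
      simp at this)
    (by
      intro ζ hζ
      have hζ' : ∀ i k, a i k ζ ≠ 0 := fun i k =>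
        hζ _ (Finset.mem_image.2 ⟨(i, k), Finset.mem_univ _, rfl⟩)
      have t1 := tiling Δ _ hΔ hreg (fun i => a (Sum.inl i)) (fun i => hbi (Sum.inl i))
        (fun i => hrep (Sum.inl i)) ζ (fun i => hζ' (Sum.inl i))
      have t2 := tiling Δ' _ hΔ' hreg' (fun i => a (Sum.inr i)) (fun i => hbi (Sum.inr i))
        (fun i => hrep (Sum.inr i)) ζ (fun i => hζ' (Sum.inr i))
      rw [Fintype.sum_sum_type]
      simp only [C, Sum.elim_inl, Sum.elim_inr, one_mul, neg_mul, Finset.sum_neg_distrib]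
      rw [t1, t2, add_neg_cancel])
    ξ (fun i k => by rw [haA]; exact hA0 i k)
  simp only [Module.Dual.eval_apply, hsgn, haA] at main
  rw [Fintype.sum_sum_type] at main
  simp only [C, W, A, Sum.elim_inl, Sum.elim_inr, one_mul, neg_mul,
    Finset.sum_neg_distrib] at main
  unfold localContrib
  simp only [term_eq v x _ _ (hgen _), term_eq v x _ _ (hgen' _)]
  linarith
end
end
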